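/- Let n ≥ 2, s > -1 and let m ∈ {0,1,…,n}. There exist constants 0 < c < C < ∞ depending only on n, s, m such that for every M-harmonic function f on B_n one has (in the extended reals) c·‖f‖²_{W^m(μ_s)} ≤ Σ_{l=0}^m Σ_{k=0}^l Σ_{j₁,…,j_{l-k}=0}^{2n²} ‖N^k X_{j₁}⋯X_{j_{l-k}} f‖²_s ≤ C·‖f‖²_{W^m(μ_s)}; in particular the middle quantity is finite if and only if all partial derivatives of f of order at most m lie in L²(B_n, dμ_s). -/

import Mathlib

open MeasureTheory ENNReal NNReal

/-- Pochhammer symbol `(a)_k = Γ(a+k)/Γ(a)`. -/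
noncomputable def poch (a : ℝ) (k : ℕ) : ℝ := Real.Gamma (a + k) / Real.Gamma a

/-- Gauss hypergeometric function `₂F₁(a,b;c;t)`, as a sum of its series. -/
noncomputable def hyp2F1 (a b c t : ℝ) : ℝ :=
  ∑' k : ℕ, (poch a k * poch b k) / (poch c k * (Nat.factorial k)) * t ^ k

/-- `S_pq(t)`. -/
noncomputable def Spq (n p q : ℕ) (t : ℝ) : ℝ :=
  (Real.Gamma (n + p) * Real.Gamma (n + q)) / (Real.Gamma n * Real.Gamma ((n : ℝ) + p + q)) *
    hyp2F1 p q ((p : ℝ) + q + n) t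

/-- `c_pq(s)`. -/
noncomputable def cpq (n p q : ℕ) (s : ℝ) : ℝ :=
  poch (s + 1) n / Real.Gamma n *
    ∫ t in Set.Ioo (0:ℝ) 1, t ^ ((p : ℝ) + q + n - 1) * (1 - t) ^ s * (Spq n p q t) ^ 2
noncomputable instance (n : ℕ) : MeasurableSpace (EuclideanSpace ℂ (Fin n)) := borel _
instance (n : ℕ) : BorelSpace (EuclideanSpace ℂ (Fin n)) := ⟨rfl⟩
/-- Lebesgue measure on `ℂⁿ`. -/
noncomputable instance (n : ℕ) : MeasureSpace (EuclideanSpace ℂ (Fin n)) :=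
  ⟨Measure.map (⇑(PiLp.continuousLinearEquiv 2 ℝ (fun _ : Fin n => ℂ)).symm) volume⟩

abbrev En (n : ℕ) := EuclideanSpace ℂ (Fin n)

/-- Wirtinger derivative `∂f/∂z_j`. -/
noncomputable def wd (n : ℕ) (j : Fin n) (f : En n → ℂ) (z : En n) : ℂ :=
  (1/2 : ℂ) * (fderiv ℝ f z (EuclideanSpace.single j 1) -
    Complex.I * fderiv ℝ f z (EuclideanSpace.single j Complex.I))

/-- Wirtinger derivative `∂f/∂z̄_j`. -/
noncomputable def wdb (n : ℕ) (j : Fin n) (f : En n → ℂ) (z : En n) : ℂ :=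
  (1/2 : ℂ) * (fderiv ℝ f z (EuclideanSpace.single j 1) +
    Complex.I * fderiv ℝ f z (EuclideanSpace.single j Complex.I))

/-- The complex-tangential field `L_{jk} = z̄_j ∂/∂z_k − z̄_k ∂/∂z_j`. -/
noncomputable def Lop (n : ℕ) (j k : Fin n) (f : En n → ℂ) : En n → ℂ :=
  fun z => (starRingEnd ℂ) (z j) * wd n k f z - (starRingEnd ℂ) (z k) * wd n j f z

/-- The complex-tangential field `L̄_{jk} = z_j ∂/∂z̄_k − z_k ∂/∂z̄_j`. -/
noncomputable def Lbarop (n : ℕ) (j k : Fin n) (f : En n → ℂ) : En n → ℂ :=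
  fun z => z j * wdb n k f z - z k * wdb n j f z

/-- `□ = −Σ_{j,k} (L_{jk}L̄_{jk} + L̄_{jk}L_{jk})`. -/
noncomputable def BoxOp (n : ℕ) (f : En n → ℂ) : En n → ℂ :=
  fun z => -∑ j : Fin n, ∑ k : Fin n, (Lop n j k (Lbarop n j k f) z + Lbarop n j k (Lop n j k f) z)

/-- `f` is `M`-harmonic on the unit ball (of smoothness class `m`):
`Δ̃f = 4(1-|z|²) Σ_{j,k}(δ_{jk} - z_j z̄_k) ∂²f/∂z_j∂z̄_k = 0` on the ball. -/
def MHarm (n : ℕ) (m : ℕ∞) (f : En n → ℂ) : Prop :=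
  ContDiffOn ℝ m f (Metric.ball 0 1) ∧
  ∀ z ∈ Metric.ball (0 : En n) 1,
    (4 : ℂ) * (1 - (‖z‖ : ℂ) ^ 2) *
      ∑ j : Fin n, ∑ k : Fin n,
        ((if j = k then 1 else 0) - z j * (starRingEnd ℂ) (z k)) * wd n j (wdb n k f) z = 0

/-- `‖f‖²_s = ∫_{B_n} |f|² dμ_s` as an extended real. -/
noncomputable def nsqE (n : ℕ) (s : ℝ) (f : En n → ℂ) : ℝ≥0∞ :=
  ∫⁻ z in Metric.ball (0 : En n) 1,
    ENNReal.ofReal (poch (s + 1) n / Real.pi ^ n * (1 - ‖z‖ ^ 2) ^ s * ‖f z‖ ^ 2)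

/-- `‖f‖²_s = ∫_{B_n} |f|² dμ_s` as a real number. -/
noncomputable def normSqS (n : ℕ) (s : ℝ) (f : En n → ℂ) : ℝ :=
  ∫ z in Metric.ball (0 : En n) 1,
    poch (s + 1) n / Real.pi ^ n * (1 - ‖z‖ ^ 2) ^ s * ‖f z‖ ^ 2

/-- The normalized surface measure `σ` on the unit sphere `∂B_n`. -/
noncomputable def sphMeas (n : ℕ) : Measure (Metric.sphere (0 : En n) 1) :=
  ((volume : Measure (En n)).toSphere Set.univ)⁻¹ • (volume : Measure (En n)).toSphere

/-- `‖g‖²_{∂B_n} = ∫_{∂B_n} |g|² dσ`. -/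
noncomputable def normSqSphere (n : ℕ) (g : En n → ℂ) : ℝ :=
  ∫ ζ : Metric.sphere (0 : En n) 1, ‖g (ζ : En n)‖ ^ 2 ∂ sphMeas n

/-- Membership in `H̃^{pq}`: `P` is a polynomial in `z, z̄`, homogeneous of bidegree `(p,q)`,
and harmonic for the Euclidean Laplacian `Δ = 4 Σ_j ∂²/∂z_j∂z̄_j` on `ℝ^{2n}`. -/
def InHtilde (n : ℕ) (p q : ℕ) (P : En n → ℂ) : Prop :=
  (∃ Q : MvPolynomial (Fin n ⊕ Fin n) ℂ,
    (∀ z : En n,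
      P z = MvPolynomial.eval (Sum.elim (fun j => z j) (fun j => (starRingEnd ℂ) (z j))) Q) ∧
    ∀ d ∈ Q.support,
      (∑ j : Fin n, d (Sum.inl j)) = p ∧ (∑ j : Fin n, d (Sum.inr j)) = q) ∧
  ∀ z : En n, ∑ j : Fin n, wd n j (wdb n j P) z = 0

/-- The complex normal derivative `R = X₀ = Σ_j (z_j ∂/∂z_j − z̄_j ∂/∂z̄_j)`. -/
noncomputable def Rop (n : ℕ) (f : En n → ℂ) : En n → ℂ :=
  fun z => ∑ j : Fin n, (z j * wd n j f z - (starRingEnd ℂ) (z j) * wdb n j f z)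

/-- The radial derivative `N = Σ_j (z_j ∂/∂z_j + z̄_j ∂/∂z̄_j)`. -/
noncomputable def Nop (n : ℕ) (f : En n → ℂ) : En n → ℂ :=
  fun z => ∑ j : Fin n, (z j * wd n j f z + (starRingEnd ℂ) (z j) * wdb n j f z)

/-- Index type for the `2n²+1` operators `X₀ = R`, `L_{jk}`, `L̄_{jk}`. -/
abbrev iotaX0 (n : ℕ) := Unit ⊕ ((Fin n × Fin n) ⊕ (Fin n × Fin n))

/-- The enumeration `X_0, X_1, …, X_{2n²}`. -/
noncomputable def Xop0 (n : ℕ) : iotaX0 n → (En n → ℂ) → En n → ℂ :=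
  Sum.elim (fun _ => Rop n)
    (Sum.elim (fun jk => Lop n jk.1 jk.2) (fun jk => Lbarop n jk.1 jk.2))

/-- Iterated operator `X_{j₁} ⋯ X_{j_m} f`. -/
noncomputable def iterX0 (n : ℕ) {m : ℕ} (js : Fin m → iotaX0 n) (f : En n → ℂ) : En n → ℂ :=
  (List.ofFn js).foldr (fun j g => Xop0 n j g) f

/-- The iterated Wirtinger derivative `∂^α f` (resp. `∂̄^β f` with `op = wdb`). -/
noncomputable def multiOp (n : ℕ) (op : Fin n → (En n → ℂ) → En n → ℂ) (α : Fin n → ℕ)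
    (f : En n → ℂ) : En n → ℂ :=
  (List.finRange n).foldr (fun j g => (op j)^[α j] g) f

/-- The squared Sobolev norm `‖f‖²_{W^m(μ_s)} = Σ_{|α|+|β|≤m} ‖∂^α ∂̄^β f‖²_s`. -/
noncomputable def WmSqE (n m : ℕ) (s : ℝ) (f : En n → ℂ) : ℝ≥0∞ :=
  ∑ α : Fin n → Fin (m + 1), ∑ β : Fin n → Fin (m + 1),
    if (∑ j : Fin n, (α j : ℕ)) + (∑ j : Fin n, (β j : ℕ)) ≤ m then
      nsqE n s (multiOp n (wd n) (fun j => α j) (multiOp n (wdb n) (fun j => β j) f))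
    else 0

section OperatorWords

/-- The composition `D i₁ ∘ ⋯ ∘ D iₖ` along a list `[i₁, …, iₖ]` of indices. -/
def opWord {ι α : Type*} (D : ι → α → α) (l : List ι) (f : α) : α := l.foldr D f

@[simp] lemma opWord_nil {ι α : Type*} (D : ι → α → α) (f : α) : opWord D [] f = f := rfl

@[simp] lemma opWord_cons {ι α : Type*} (D : ι → α → α) (i : ι) (l : List ι) (f : α) :
    opWord D (i :: l) f = D i (opWord D l f) := rfl

variable {S ι κ : Type*} [CommRing S] [Algebra ℂ S]

/-- The `S`-module of operators generated by the words of length at most `m`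
in a family of derivations. -/
def wordSpan (D : ι → Derivation ℂ S S) (m : ℕ) : Submodule S (S → S) :=
  Submodule.span S {P | ∃ l : List ι, l.length ≤ m ∧ P = opWord (fun i => D i) l}

lemma opWord_mem_wordSpan (D : ι → Derivation ℂ S S) {m : ℕ} {l : List ι} (hl : l.length ≤ m) :
    opWord (fun i => D i) l ∈ wordSpan D m :=
  Submodule.subset_span ⟨l, hl, rfl⟩

lemma wordSpan_mono (D : ι → Derivation ℂ S S) {m m' : ℕ} (h : m ≤ m') :
    wordSpan D m ≤ wordSpan D m' :=
  Submodule.span_mono fun _ ⟨l, hl, hP⟩ => ⟨l, hl.trans h, hP⟩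

lemma comp_mem_wordSpan (D : ι → Derivation ℂ S S) (i : ι) {m : ℕ} {P : S → S}
    (hP : P ∈ wordSpan D m) : (fun f => D i (P f)) ∈ wordSpan D (m + 1) := by
  induction hP using Submodule.span_induction with
  | mem P h =>
    obtain ⟨l, hl, rfl⟩ := h
    exact opWord_mem_wordSpan (l := i :: l) D (by simpa using hl)
  | zero => convert (wordSpan D (m + 1)).zero_mem using 1; ext; simp
  | add P Q _ _ hP hQ =>
    have : (fun f => D i ((P + Q) f)) = (fun f => D i (P f)) + fun f => D i (Q f) := by
      ext f; simp
    rw [this]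
    exact add_mem hP hQ
  | smul a P hP' hP =>
    have : (fun f => D i ((a • P) f)) = a • (fun f => D i (P f)) + D i a • P := by
      ext f; simp [mul_comm]
    rw [this]
    exact add_mem (Submodule.smul_mem _ _ hP)
      (Submodule.smul_mem _ _ (wordSpan_mono D m.le_succ hP'))

lemma comp_mem_wordSpan_of_mem_span (D : ι → Derivation ℂ S S) {E : Derivation ℂ S S}
    (hE : E ∈ Submodule.span S (Set.range D)) {m : ℕ} {P : S → S}
    (hP : P ∈ wordSpan D m) : (fun f => E (P f)) ∈ wordSpan D (m + 1) := by
  induction hE using Submodule.span_induction with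
  | mem E h =>
    obtain ⟨i, rfl⟩ := h
    exact comp_mem_wordSpan D i hP
  | zero => convert (wordSpan D (m + 1)).zero_mem using 1; ext; simp
  | add E F _ _ hE hF => exact add_mem hE hF
  | smul a E _ hE => exact Submodule.smul_mem _ a hE

/-- If `u • E k` is a combination of the derivations `D i` for every `k`, then a word in the `E k`
of length `m`, multiplied by `u ^ (2 m)`, is a combination of words in the `D i`. -/
lemma pow_mul_opWord_mem_wordSpan (D : ι → Derivation ℂ S S) (E : κ → Derivation ℂ S S) (u : S)
    (hE : ∀ k, u • E k ∈ Submodule.span S (Set.range D)) (l : List κ) :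
    (fun f => u ^ (2 * l.length) * opWord (fun k => E k) l f) ∈ wordSpan D l.length := by
  induction l with
  | nil =>
    have : (fun f => u ^ (2 * ([] : List κ).length) * opWord (fun k => E k) [] f) =
        opWord (fun i => D i) [] := by ext; simp
    rw [this]
    exact opWord_mem_wordSpan (l := []) D le_rfl
  | cons k l ih =>
    have h₁ := comp_mem_wordSpan_of_mem_span D (hE k) ih
    have : (fun f => u ^ (2 * (k :: l).length) * opWord (fun k => E k) (k :: l) f) =
        u • (fun f => (u • E k) (u ^ (2 * l.length) * opWord (fun k => E k) l f)) -
        ((2 * l.length : ℕ) * u * E k u) •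
          (fun f => u ^ (2 * l.length) * opWord (fun k => E k) l f) := by
      ext f
      simp only [List.length_cons, opWord_cons, Pi.sub_apply, Pi.smul_apply, smul_eq_mul,
        Derivation.smul_apply, Derivation.leibniz, Derivation.leibniz_pow, nsmul_eq_mul]
      rw [show 2 * (l.length + 1) = 2 * l.length + 2 by ring]
      generalize 2 * l.length = p
      rcases p with _ | p
      · simp
        ring
      · simp only [Nat.add_sub_cancel]
        ring
    rw [this]
    exact sub_mem (Submodule.smul_mem _ _ h₁)
      (Submodule.smul_mem _ _ (wordSpan_mono D (Nat.le_succ _) ih))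

end OperatorWords

section Wirtinger

variable {S ι : Type*} [CommRing S] [Algebra ℂ S] [Fintype ι] [DecidableEq ι]

/-- Commuting derivations `∂/∂x_i` and `∂/∂y_i` with respect to coordinates `x_i` and `y_i`. -/
structure WirtingerSystem (d e : ι → Derivation ℂ S S) (x y : ι → S) : Prop where
  d_x : ∀ i j, d i (x j) = if i = j then 1 else 0
  d_y : ∀ i j, d i (y j) = 0
  e_x : ∀ i j, e i (x j) = 0
  e_y : ∀ i j, e i (y j) = if i = j then 1 else 0
  d_d : ∀ i j f, d i (d j f) = d j (d i f)
  d_e : ∀ i j f, d i (e j f) = e j (d i f)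
  e_e : ∀ i j f, e i (e j f) = e j (e i f)

/-- The Euler derivation `Σ x_j ∂/∂x_j`. -/
def eulerDer (d : ι → Derivation ℂ S S) (x : ι → S) : Derivation ℂ S S := ∑ j, x j • d j

/-- The operator `Σ_{j,k} (δ_{jk} - x_j y_k) ∂²/∂x_j∂y_k`. -/
def mobLap (d e : ι → Derivation ℂ S S) (x y : ι → S) (f : S) : S :=
  ∑ j, d j (e j f) - eulerDer d x (eulerDer e y f)

/-- An infinitesimal automorphism of the ball. -/
def mobDer (d e : ι → Derivation ℂ S S) (y : ι → S) (i : ι) : Derivation ℂ S S :=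
  d i - y i • eulerDer e y

omit [DecidableEq ι] in
lemma eulerDer_apply (d : ι → Derivation ℂ S S) (x : ι → S) (f : S) :
    eulerDer d x f = ∑ j, x j * d j f := by
  simp only [eulerDer, ← Derivation.coeFnAddMonoidHom_apply, map_sum, Finset.sum_apply]
  simp

namespace WirtingerSystem

variable {d e : ι → Derivation ℂ S S} {x y : ι → S}

omit [Fintype ι] in
lemma symm (h : WirtingerSystem d e x y) : WirtingerSystem e d y x :=
  ⟨h.e_y, h.e_x, h.d_y, h.d_x, h.e_e, fun i j f => (h.d_e j i f).symm, h.d_d⟩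

lemma euler_x (h : WirtingerSystem d e x y) (i : ι) : eulerDer d x (x i) = x i := by
  simp [eulerDer_apply, h.d_x]

lemma euler_y (h : WirtingerSystem d e x y) (i : ι) : eulerDer d x (y i) = 0 := by
  simp [eulerDer_apply, h.d_y]

lemma d_euler (h : WirtingerSystem d e x y) (i : ι) (f : S) :
    d i (eulerDer d x f) = eulerDer d x (d i f) + d i f := by
  simp [eulerDer_apply, h.d_x, Finset.sum_add_distrib, h.d_d i]

lemma e_euler (h : WirtingerSystem d e x y) (i : ι) (f : S) :
    e i (eulerDer d x f) = eulerDer d x (e i f) := by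
  simp [eulerDer_apply, h.e_x, h.d_e]

lemma euler_euler (h : WirtingerSystem d e x y) (f : S) :
    eulerDer d x (eulerDer e y f) = eulerDer e y (eulerDer d x f) := by
  conv_rhs => rw [eulerDer_apply d x f]
  rw [eulerDer_apply d x]
  simp [h.symm.euler_y, h.symm.e_euler]

lemma mobLap_symm (h : WirtingerSystem d e x y) (f : S) :
    mobLap e d y x f = mobLap d e x y f := by
  simp [mobLap, h.euler_euler, h.d_e]

lemma mobLap_mobDer (h : WirtingerSystem d e x y) (i : ι) (f : S) :
    mobLap d e x y (mobDer d e y i f) =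
      mobDer d e y i (mobLap d e x y f) - y i * mobLap d e x y f := by
  have h₁ : ∑ j, d j (e j (y i * eulerDer e y f)) =
      y i * (eulerDer e y (∑ j, d j (e j f)) + ∑ j, d j (e j f)) + d i (eulerDer e y f) := by
    have hj (j : ι) : d j (e j (y i * eulerDer e y f)) =
        y i * (eulerDer e y (d j (e j f)) + d j (e j f)) +
          (if j = i then d j (eulerDer e y f) else 0) := by
      simp only [Derivation.leibniz, smul_eq_mul, map_add, h.symm.d_euler, h.symm.e_euler, h.d_y,
        h.e_y]
      split_ifs <;> simp
    simp only [hj]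
    simp [Finset.sum_add_distrib, Finset.mul_sum, mul_add]
  have h₂ : ∑ j, d j (e j (d i f)) = d i (∑ j, d j (e j f)) := by
    simp [← h.d_e, h.d_d i]
  simp only [mobLap, mobDer, Derivation.sub_apply, Derivation.smul_apply, map_sub, smul_eq_mul,
    Finset.sum_sub_distrib, h₁, h₂]
  simp only [Derivation.leibniz, h.symm.euler_x, h.euler_y, h.d_euler, smul_eq_mul,
    h.symm.e_euler, map_add, h.euler_euler]
  ring

lemma euler_field (h : WirtingerSystem d e x y) (j k : ι) (f : S) :
    eulerDer d x (y j * d k f - y k * d j f) =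
      y j * d k (eulerDer d x f) - y k * d j (eulerDer d x f) - (y j * d k f - y k * d j f) := by
  simp [h.euler_y, h.d_euler]
  ring

lemma euler_field' (h : WirtingerSystem d e x y) (j k : ι) (f : S) :
    eulerDer e y (y j * d k f - y k * d j f) =
      y j * d k (eulerDer e y f) - y k * d j (eulerDer e y f) + (y j * d k f - y k * d j f) := by
  simp [h.symm.euler_x, h.symm.e_euler]
  ring

end WirtingerSystem

/-- The complex-tangential derivation `y_j ∂/∂x_k - y_k ∂/∂x_j`. -/
def tangDer (d : ι → Derivation ℂ S S) (y : ι → S) (jk : ι × ι) : Derivation ℂ S S :=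
  y jk.1 • d jk.2 - y jk.2 • d jk.1

/-- The complex normal derivation `R` together with the tangential derivations. -/
def fieldDer (d e : ι → Derivation ℂ S S) (x y : ι → S) :
    Unit ⊕ ((ι × ι) ⊕ (ι × ι)) → Derivation ℂ S S :=
  Sum.elim (fun _ => eulerDer d x - eulerDer e y) (Sum.elim (tangDer d y) (tangDer e x))

/-- The radial derivation `N`. -/
def radDer (d e : ι → Derivation ℂ S S) (x y : ι → S) : Derivation ℂ S S :=
  eulerDer d x + eulerDer e y

lemma WirtingerSystem.radDer_comm {d e : ι → Derivation ℂ S S} {x y : ι → S}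
    (h : WirtingerSystem d e x y) (i : Unit ⊕ ((ι × ι) ⊕ (ι × ι))) (f : S) :
    radDer d e x y (fieldDer d e x y i f) = fieldDer d e x y i (radDer d e x y f) := by
  rcases i with _ | jk | jk
  · simp [radDer, fieldDer, h.euler_euler]
    ring
  · have h₁ := h.euler_field jk.1 jk.2 f
    have h₂ := h.euler_field' jk.1 jk.2 f
    simp only [radDer, fieldDer, tangDer, Sum.elim_inr, Sum.elim_inl, Derivation.sub_apply,
      Derivation.smul_apply, Derivation.add_apply, smul_eq_mul, map_add, h₁, h₂]
    ring
  · have h₁ := h.symm.euler_field jk.1 jk.2 f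
    have h₂ := h.symm.euler_field' jk.1 jk.2 f
    simp only [radDer, fieldDer, tangDer, Sum.elim_inr, Derivation.sub_apply,
      Derivation.smul_apply, Derivation.add_apply, smul_eq_mul, map_add, h₁, h₂]
    ring

/-- The family `N, R, L_{jk}, L̄_{jk}`. -/
def polarDer (d e : ι → Derivation ℂ S S) (x y : ι → S) :
    Option (Unit ⊕ ((ι × ι) ⊕ (ι × ι))) → Derivation ℂ S S :=
  fun i => i.elim (radDer d e x y) (fieldDer d e x y)

omit [DecidableEq ι] in
lemma eulerDer_mem_span (d e : ι → Derivation ℂ S S) (x : ι → S) :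
    eulerDer d x ∈ Submodule.span S (Set.range (Sum.elim d e)) :=
  Submodule.sum_mem _ fun j _ => Submodule.smul_mem _ _ (Submodule.subset_span ⟨Sum.inl j, rfl⟩)

omit [DecidableEq ι] in
lemma eulerDer_mem_span' (d e : ι → Derivation ℂ S S) (y : ι → S) :
    eulerDer e y ∈ Submodule.span S (Set.range (Sum.elim d e)) :=
  Submodule.sum_mem _ fun j _ => Submodule.smul_mem _ _ (Submodule.subset_span ⟨Sum.inr j, rfl⟩)

omit [DecidableEq ι] in
lemma polarDer_mem_span (d e : ι → Derivation ℂ S S) (x y : ι → S) (i) :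
    polarDer d e x y i ∈ Submodule.span S (Set.range (Sum.elim d e)) := by
  have hd j : d j ∈ Submodule.span S (Set.range (Sum.elim d e)) :=
    Submodule.subset_span ⟨Sum.inl j, rfl⟩
  have he j : e j ∈ Submodule.span S (Set.range (Sum.elim d e)) :=
    Submodule.subset_span ⟨Sum.inr j, rfl⟩
  have h₁ := eulerDer_mem_span d e x
  have h₂ := eulerDer_mem_span' d e y
  rcases i with _ | _ | jk | jk
  · exact add_mem h₁ h₂
  · exact sub_mem h₁ h₂
  · exact sub_mem (Submodule.smul_mem _ _ (hd _)) (Submodule.smul_mem _ _ (hd _))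
  · exact sub_mem (Submodule.smul_mem _ _ (he _)) (Submodule.smul_mem _ _ (he _))

omit [DecidableEq ι] in
lemma normSq_smul_mem_span (d e : ι → Derivation ℂ S S) (x y : ι → S) (i : ι ⊕ ι) :
    (∑ j, x j * y j) • Sum.elim d e i ∈ Submodule.span S (Set.range (polarDer d e x y)) := by
  set M := Submodule.span S (Set.range (polarDer d e x y)) with hM
  have hN : radDer d e x y ∈ M := Submodule.subset_span ⟨none, rfl⟩
  have hX i : fieldDer d e x y i ∈ M := Submodule.subset_span ⟨some i, rfl⟩
  have hR := hX (Sum.inl ())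
  have hL jk := hX (Sum.inr (Sum.inl jk))
  have hLb jk := hX (Sum.inr (Sum.inr jk))
  have hQ : eulerDer d x ∈ M := by
    have := Submodule.smul_mem M (algebraMap ℂ S (1 / 2)) (add_mem hN hR)
    convert this using 1
    simp only [radDer, fieldDer, Sum.elim_inl]
    rw [add_add_sub_cancel, ← two_smul ℂ (eulerDer d x), algebraMap_smul, smul_smul]
    norm_num
  have hQb : eulerDer e y ∈ M := by
    have := sub_mem hN hQ
    simpa [radDer] using this
  rcases i with k | k
  · have : (∑ j, x j * y j) • d k =
        y k • eulerDer d x + ∑ j, x j • tangDer d y (j, k) := by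
      simp only [tangDer, eulerDer, smul_sub, Finset.sum_sub_distrib, smul_smul, Finset.sum_smul,
        Finset.smul_sum]
      simp [mul_comm]
    simp only [Sum.elim_inl, this]
    exact add_mem (Submodule.smul_mem _ _ hQ)
      (Submodule.sum_mem _ fun j _ => Submodule.smul_mem _ _ (hL _))
  · have : (∑ j, x j * y j) • e k =
        x k • eulerDer e y + ∑ j, y j • tangDer e x (j, k) := by
      simp only [tangDer, eulerDer, smul_sub, Finset.sum_sub_distrib, smul_smul, Finset.sum_smul,
        Finset.smul_sum]
      simp [mul_comm]
    simp only [Sum.elim_inr, this]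
    exact add_mem (Submodule.smul_mem _ _ hQb)
      (Submodule.sum_mem _ fun j _ => Submodule.smul_mem _ _ (hLb _))

/-- The infinitesimal automorphisms of the ball together with their conjugates. -/
def mobFam (d e : ι → Derivation ℂ S S) (x y : ι → S) : ι ⊕ ι → Derivation ℂ S S :=
  Sum.elim (mobDer d e y) (mobDer e d x)

omit [DecidableEq ι] in
lemma sum_smul_mobDer (d e : ι → Derivation ℂ S S) (x y : ι → S) :
    ∑ j, x j • mobDer d e y j = eulerDer d x - (∑ j, x j * y j) • eulerDer e y := by
  simp [mobDer, smul_sub, Finset.sum_sub_distrib, smul_smul, Finset.sum_smul, ← eulerDer.eq_1 d x]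

omit [DecidableEq ι] in
lemma smul_mem_span_mobFam (d e : ι → Derivation ℂ S S) (x y : ι → S) (i : ι ⊕ ι) :
    (1 - (∑ j, x j * y j) ^ 2) • Sum.elim d e i ∈
      Submodule.span S (Set.range (mobFam d e x y)) := by
  set M := Submodule.span S (Set.range (mobFam d e x y)) with hM
  have hA i : mobDer d e y i ∈ M := Submodule.subset_span ⟨Sum.inl i, rfl⟩
  have hB i : mobDer e d x i ∈ M := Submodule.subset_span ⟨Sum.inr i, rfl⟩
  have hsA : ∑ j, x j • mobDer d e y j ∈ M :=
    Submodule.sum_mem _ fun j _ => Submodule.smul_mem _ _ (hA j)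
  have hsB : ∑ j, y j • mobDer e d x j ∈ M :=
    Submodule.sum_mem _ fun j _ => Submodule.smul_mem _ _ (hB j)
  rw [sum_smul_mobDer] at hsA hsB
  simp only [mul_comm (y _)] at hsB
  set ρ := ∑ j, x j * y j
  have hQ : (1 - ρ ^ 2) • eulerDer d x ∈ M := by
    convert add_mem hsA (Submodule.smul_mem M ρ hsB) using 1
    simp only [smul_sub, smul_smul, sub_smul, one_smul, sq]
    abel
  have hQb : (1 - ρ ^ 2) • eulerDer e y ∈ M := by
    convert add_mem hsB (Submodule.smul_mem M ρ hsA) using 1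
    simp only [smul_sub, smul_smul, sub_smul, one_smul, sq]
    abel
  rcases i with k | k
  · have : (1 - ρ ^ 2) • d k =
        (1 - ρ ^ 2) • mobDer d e y k + y k • (1 - ρ ^ 2) • eulerDer e y := by
      simp only [mobDer, smul_sub, smul_smul, mul_comm (y k)]
      abel
    simp only [Sum.elim_inl, this]
    exact add_mem (Submodule.smul_mem _ _ (hA k)) (Submodule.smul_mem _ _ hQb)
  · have : (1 - ρ ^ 2) • e k =
        (1 - ρ ^ 2) • mobDer e d x k + x k • (1 - ρ ^ 2) • eulerDer d x := by
      simp only [mobDer, smul_sub, smul_smul, mul_comm (x k)]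
      abel
    simp only [Sum.elim_inr, this]
    exact add_mem (Submodule.smul_mem _ _ (hB k)) (Submodule.smul_mem _ _ hQ)

end Wirtinger

section SmoothFunctions

variable {n : ℕ}

/-- The algebra of smooth complex functions on `ℂⁿ`. -/
def smoothAlg (n : ℕ) : Subalgebra ℂ (En n → ℂ) where
  carrier := {f : En n → ℂ | ContDiff ℝ (⊤ : ℕ∞) f}
  mul_mem' {f _} hf hg := ContDiff.mul (show ContDiff ℝ (⊤ : ℕ∞) f from hf) hg
  add_mem' {f _} hf hg := ContDiff.add (show ContDiff ℝ (⊤ : ℕ∞) f from hf) hg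
  algebraMap_mem' c := show ContDiff ℝ (⊤ : ℕ∞) fun _ : En n => c from contDiff_const

namespace smoothAlg

lemma contDiff (f : smoothAlg n) : ContDiff ℝ (⊤ : ℕ∞) (f : En n → ℂ) := f.2

lemma continuous (f : smoothAlg n) : Continuous (f : En n → ℂ) := (contDiff f).continuous

lemma differentiable (f : smoothAlg n) : Differentiable ℝ (f : En n → ℂ) :=
  (contDiff f).differentiable (by simp)

lemma contDiff_fderiv (f : smoothAlg n) : ContDiff ℝ (⊤ : ℕ∞) (fderiv ℝ (f : En n → ℂ)) :=
  (contDiff f).fderiv_right (by simp)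

/-- The directional derivative. -/
noncomputable def dirDer (v : En n) : Derivation ℂ (smoothAlg n) (smoothAlg n) :=
  Derivation.mk'
    { toFun := fun f => ⟨fun z => fderiv ℝ (f : En n → ℂ) z v,
        (contDiff_fderiv f).clm_apply contDiff_const⟩
      map_add' := fun f g => by
        ext z
        simp [fderiv_add (differentiable f).differentiableAt (differentiable g).differentiableAt]
      map_smul' := fun c f => by
        ext z
        simp [fderiv_const_smul (differentiable f).differentiableAt] }
    (fun f g => by
      ext z
      simp [fderiv_mul (differentiable f).differentiableAt (differentiable g).differentiableAt])

lemma dirDer_apply (v : En n) (f : smoothAlg n) (z : En n) :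
    (dirDer v f : En n → ℂ) z = fderiv ℝ (f : En n → ℂ) z v := rfl

lemma dirDer_comm (v w : En n) (f : smoothAlg n) :
    dirDer v (dirDer w f) = dirDer w (dirDer v f) := by
  ext z
  have hs : IsSymmSndFDerivAt ℝ (f : En n → ℂ) z :=
    (contDiff f).contDiffAt.isSymmSndFDerivAt
      (by simpa using WithTop.coe_le_coe.2 (le_top (a := (2 : ℕ∞))))
  have key (v w : En n) : (dirDer v (dirDer w f) : En n → ℂ) z =
      fderiv ℝ (fderiv ℝ (f : En n → ℂ)) z v w := by
    change fderiv ℝ (fun z => fderiv ℝ (f : En n → ℂ) z w) z v = _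
    rw [fderiv_clm_apply ((contDiff_fderiv f).differentiable (by simp)).differentiableAt
      (differentiableAt_const w)]
    simp
  rw [key, key, hs.eq]

/-- The derivation `∂/∂z_j`. -/
noncomputable def dz (j : Fin n) : Derivation ℂ (smoothAlg n) (smoothAlg n) :=
  (1 / 2 : ℂ) • (dirDer (EuclideanSpace.single j 1) -
    Complex.I • dirDer (EuclideanSpace.single j Complex.I))

/-- The derivation `∂/∂z̄_j`. -/
noncomputable def dzb (j : Fin n) : Derivation ℂ (smoothAlg n) (smoothAlg n) :=
  (1 / 2 : ℂ) • (dirDer (EuclideanSpace.single j 1) +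
    Complex.I • dirDer (EuclideanSpace.single j Complex.I))

@[simp] lemma coe_dz (j : Fin n) (f : smoothAlg n) : (dz j f : En n → ℂ) = wd n j f := rfl

@[simp] lemma coe_dzb (j : Fin n) (f : smoothAlg n) : (dzb j f : En n → ℂ) = wdb n j f := rfl

/-- The coordinate function `z_j`. -/
noncomputable def coord (j : Fin n) : smoothAlg n :=
  ⟨fun z => z j, show ContDiff ℝ (⊤ : ℕ∞) fun z : En n => z j from
    ((EuclideanSpace.proj j : En n →L[ℂ] ℂ).restrictScalars ℝ).contDiff⟩

/-- Complex conjugation of smooth functions. -/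
noncomputable def conj (f : smoothAlg n) : smoothAlg n :=
  ⟨fun z => starRingEnd ℂ ((f : En n → ℂ) z),
    show ContDiff ℝ (⊤ : ℕ∞) fun z => Complex.conjCLE ((f : En n → ℂ) z) from
      Complex.conjCLE.contDiff.comp (contDiff f)⟩

@[simp] lemma coord_apply (j : Fin n) (z : En n) : (coord j : En n → ℂ) z = z j := rfl

@[simp] lemma conj_apply (f : smoothAlg n) (z : En n) :
    (conj f : En n → ℂ) z = starRingEnd ℂ ((f : En n → ℂ) z) := rfl

lemma dirDer_conj (v : En n) (f : smoothAlg n) : dirDer v (conj f) = conj (dirDer v f) := by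
  ext z
  have h := (Complex.conjCLE : ℂ →L[ℝ] ℂ).hasFDerivAt.comp z
    ((differentiable f).differentiableAt (x := z)).hasFDerivAt
  exact congrArg (fun L => L v) h.fderiv

lemma dz_conj (j : Fin n) (f : smoothAlg n) : dz j (conj f) = conj (dzb j f) := by
  ext z
  have h v := congrArg (fun g : smoothAlg n => (g : En n → ℂ) z) (dirDer_conj v f)
  simp only [conj_apply, dirDer_apply] at h
  simp [wd, wdb, h, sub_eq_add_neg, show (starRingEnd ℂ) 2 = 2 from Complex.conj_ofNat 2]

lemma dzb_conj (j : Fin n) (f : smoothAlg n) : dzb j (conj f) = conj (dz j f) := by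
  ext z
  have h v := congrArg (fun g : smoothAlg n => (g : En n → ℂ) z) (dirDer_conj v f)
  simp only [conj_apply, dirDer_apply] at h
  simp [wd, wdb, h, sub_eq_add_neg, show (starRingEnd ℂ) 2 = 2 from Complex.conj_ofNat 2]

lemma dirDer_coord (v : En n) (j : Fin n) (z : En n) :
    (dirDer v (coord j) : En n → ℂ) z = v j :=
  congrArg (fun L => L v)
    ((EuclideanSpace.proj j : En n →L[ℂ] ℂ).restrictScalars ℝ).hasFDerivAt.fderiv

lemma dz_coord (i j : Fin n) : dz i (coord j) = if i = j then 1 else 0 := by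
  ext z
  have h v := dirDer_coord v j z
  simp only [dirDer_apply] at h
  rw [coe_dz, wd, h, h]
  split_ifs with hij
  · subst hij
    norm_num [← mul_assoc]
  · simp [Ne.symm hij]

lemma dzb_coord (i j : Fin n) : dzb i (coord j) = 0 := by
  ext z
  have h v := dirDer_coord v j z
  simp only [dirDer_apply] at h
  rw [coe_dzb, wdb, h, h]
  by_cases hij : j = i <;> simp [hij]

lemma wirtingerSystem (n : ℕ) :
    WirtingerSystem (dz (n := n)) dzb coord (fun j => conj (coord j)) where
  d_x := dz_coord
  d_y i j := by rw [dz_conj, dzb_coord]; ext; simp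
  e_x := dzb_coord
  e_y i j := by
    rw [dzb_conj, dz_coord]
    split_ifs <;> ext <;> simp
  d_d i j f := by simp [dz, dirDer_comm (EuclideanSpace.single i _)]; module
  d_e i j f := by simp [dz, dzb, dirDer_comm (EuclideanSpace.single i _)]; module
  e_e i j f := by simp [dzb, dirDer_comm (EuclideanSpace.single i _)]; module

end smoothAlg

end SmoothFunctions

section OperatorWords

lemma opWord_append {ι α : Type*} (D : ι → α → α) (l l' : List ι) (f : α) :
    opWord D (l ++ l') f = opWord D l (opWord D l' f) := List.foldr_append

lemma opWord_map {ι κ α : Type*} (D : ι → α → α) (g : κ → ι) (l : List κ) (f : α) :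
    opWord D (l.map g) f = opWord (fun k => D (g k)) l f := List.foldr_map

lemma opWord_replicate {ι α : Type*} (D : ι → α → α) (i : ι) (k : ℕ) (f : α) :
    opWord D (List.replicate k i) f = (D i)^[k] f := by
  induction k with
  | zero => rfl
  | succ k ih => rw [List.replicate_succ, opWord_cons, ih, Function.iterate_succ_apply']

lemma opWord_flatMap {ι κ α : Type*} (D : ι → α → α) (g : κ → List ι) (l : List κ) (f : α) :
    opWord D (l.flatMap g) f = opWord (fun k => opWord D (g k)) l f := by
  induction l with
  | nil => rfl
  | cons k l ih => rw [List.flatMap_cons, opWord_append, ih, opWord_cons]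

lemma opWord_perm {ι α : Type*} {D : ι → α → α} (hD : ∀ i j f, D i (D j f) = D j (D i f))
    {l l' : List ι} (h : l.Perm l') (f : α) : opWord D l f = opWord D l' f := by
  induction h with
  | nil => rfl
  | cons i _ ih => rw [opWord_cons, ih, opWord_cons]
  | swap i j l => exact hD j i _
  | trans _ _ ih₁ ih₂ => exact ih₁.trans ih₂

/-- If one operator commutes with the others, its occurrences in a word can be moved in front. -/
lemma exists_opWord_eq_append {ι α : Type*} {D : Option ι → α → α}
    (hD : ∀ i f, D none (D (some i) f) = D (some i) (D none f)) (l : List (Option ι)) :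
    ∃ (k : ℕ) (l' : List ι), k + l'.length = l.length ∧
      ∀ f, opWord D l f = opWord D (List.replicate k none ++ l'.map some) f := by
  have hD' (i : ι) (k : ℕ) (f : α) :
      D (some i) ((D none)^[k] f) = (D none)^[k] (D (some i) f) := by
    induction k generalizing f with
    | zero => rfl
    | succ k ih => rw [Function.iterate_succ_apply, ih, Function.iterate_succ_apply, hD]
  induction l with
  | nil => exact ⟨0, [], rfl, fun _ => rfl⟩
  | cons i l ih =>
    obtain ⟨k, l', hk, h⟩ := ih
    rcases i with _ | i
    · exact ⟨k + 1, l', by simp [← hk]; ring, fun f => by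
        rw [opWord_cons, h, List.replicate_succ, List.cons_append, opWord_cons]⟩
    · exact ⟨k, i :: l', by simp [← hk]; ring, fun f => by
        rw [opWord_cons, h, opWord_append, opWord_append, opWord_replicate, opWord_replicate, hD',
          List.map_cons, opWord_cons]⟩

/-- The list of indices of the monomial `∂^α ∂̄^β`. -/
def monomialWord {n : ℕ} (α β : Fin n → ℕ) : List (Fin n ⊕ Fin n) :=
  ((List.finRange n).flatMap fun j => List.replicate (α j) j).map Sum.inl ++
    ((List.finRange n).flatMap fun j => List.replicate (β j) j).map Sum.inr

lemma length_monomialWord {n : ℕ} (α β : Fin n → ℕ) :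
    (monomialWord α β).length = ∑ j, α j + ∑ j, β j := by
  simp [monomialWord, List.length_flatMap, Fin.sum_univ_def]

lemma count_flatMap_replicate {n : ℕ} (α : Fin n → ℕ) (i : Fin n) :
    ((List.finRange n).flatMap fun j => List.replicate (α j) j).count i = α i := by
  simp [List.count_flatMap, Function.comp_def, List.count_replicate, ← Fin.sum_univ_def]

lemma exists_perm_monomialWord {n : ℕ} (l : List (Fin n ⊕ Fin n)) :
    ∃ α β : Fin n → ℕ, l.Perm (monomialWord α β) := by
  let : BEq (Fin n ⊕ Fin n) := instBEqOfDecidableEq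
  refine ⟨fun j => l.count (Sum.inl j), fun j => l.count (Sum.inr j), ?_⟩
  rw [List.perm_iff_count]
  have h₁ (L : List (Fin n)) (j : Fin n) :
      (L.map (Sum.inl : _ → Fin n ⊕ Fin n)).count (Sum.inr j) = 0 :=
    List.count_eq_zero.2 (by simp)
  have h₂ (L : List (Fin n)) (j : Fin n) :
      (L.map (Sum.inr : _ → Fin n ⊕ Fin n)).count (Sum.inl j) = 0 :=
    List.count_eq_zero.2 (by simp)
  rintro (j | j)
  · rw [monomialWord, List.count_append, h₂, List.count_map_of_injective _ _ Sum.inl_injective,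
      count_flatMap_replicate, add_zero]
  · rw [monomialWord, List.count_append, h₁, List.count_map_of_injective _ _ Sum.inr_injective,
      count_flatMap_replicate, zero_add]

end OperatorWords

section Operators

variable {n : ℕ}

/-- The Wirtinger derivatives `∂/∂z_j` and `∂/∂z̄_j`. -/
noncomputable def wirtOp (n : ℕ) : Fin n ⊕ Fin n → (En n → ℂ) → En n → ℂ :=
  Sum.elim (wd n) (wdb n)

/-- The operators `N` and `X_0, X_1, …, X_{2n²}`. -/
noncomputable def polarOp (n : ℕ) : Option (iotaX0 n) → (En n → ℂ) → En n → ℂ :=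
  fun i => i.elim (Nop n) (Xop0 n)

lemma opWord_wirtOp_monomialWord (α β : Fin n → ℕ) (f : En n → ℂ) :
    opWord (wirtOp n) (monomialWord α β) f = multiOp n (wd n) α (multiOp n (wdb n) β f) := by
  rw [monomialWord, opWord_append, opWord_map, opWord_map, opWord_flatMap, opWord_flatMap]
  have (op : Fin n → (En n → ℂ) → En n → ℂ) (α : Fin n → ℕ) :
      (fun j => opWord op (List.replicate (α j) j)) = fun j => (op j)^[α j] :=
    funext fun j => funext fun f => opWord_replicate op j (α j) f
  exact (congrArg₂ (fun A B => opWord A (List.finRange n) (opWord B (List.finRange n) f))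
    (this (wd n) α) (this (wdb n) β) :)

lemma opWord_polarOp (k l : ℕ) (js : Fin l → iotaX0 n) (f : En n → ℂ) :
    opWord (polarOp n) (List.replicate k none ++ (List.ofFn js).map some) f =
      (Nop n)^[k] (iterX0 n js f) := by
  rw [opWord_append, opWord_map, opWord_replicate]
  rfl

lemma opWord_eqOn {ι E F : Type*} [TopologicalSpace E] {D : ι → (E → F) → E → F} {V : Set E}
    (hD : ∀ i f g, Set.EqOn f g V → Set.EqOn (D i f) (D i g) V) (l : List ι) {f g : E → F}
    (h : Set.EqOn f g V) : Set.EqOn (opWord D l f) (opWord D l g) V := by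
  induction l with
  | nil => exact h
  | cons i l ih => exact hD i _ _ ih

lemma fderiv_eqOn {V : Set (En n)} (hV : IsOpen V) {f g : En n → ℂ} (h : Set.EqOn f g V) :
    Set.EqOn (fderiv ℝ f) (fderiv ℝ g) V := fun _ hz =>
  (h.eventuallyEq_of_mem (hV.mem_nhds hz)).fderiv_eq

lemma wirtOp_eqOn {V : Set (En n)} (hV : IsOpen V) (i) (f g : En n → ℂ) (h : Set.EqOn f g V) :
    Set.EqOn (wirtOp n i f) (wirtOp n i g) V := by
  intro z hz
  rcases i with i | i <;> simp [wirtOp, wd, wdb, fderiv_eqOn hV h hz]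

lemma polarOp_eqOn {V : Set (En n)} (hV : IsOpen V) (i) (f g : En n → ℂ) (h : Set.EqOn f g V) :
    Set.EqOn (polarOp n i f) (polarOp n i g) V := by
  intro z hz
  have h₁ j : wd n j f z = wd n j g z := wirtOp_eqOn hV (Sum.inl j) f g h hz
  have h₂ j : wdb n j f z = wdb n j g z := wirtOp_eqOn hV (Sum.inr j) f g h hz
  rcases i with _ | _ | i | i <;> simp [polarOp, Xop0, Nop, Rop, Lop, Lbarop, h₁, h₂]

namespace smoothAlg

/-- The derivations `∂/∂z_j` and `∂/∂z̄_j` of the algebra of smooth functions. -/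
noncomputable def wirtDer (n : ℕ) : Fin n ⊕ Fin n → Derivation ℂ (smoothAlg n) (smoothAlg n) :=
  Sum.elim dz dzb

/-- The derivations `N, R, L_{jk}, L̄_{jk}` of the algebra of smooth functions. -/
noncomputable def polDer (n : ℕ) :
    Option (iotaX0 n) → Derivation ℂ (smoothAlg n) (smoothAlg n) :=
  polarDer dz dzb coord fun j => conj (coord j)

@[simp] lemma coe_sum_apply {ι : Type*} (s : Finset ι) (f : ι → smoothAlg n) (z : En n) :
    ((∑ i ∈ s, f i : smoothAlg n) : En n → ℂ) z = ∑ i ∈ s, (f i : En n → ℂ) z := by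
  rw [AddSubmonoidClass.coe_finsetSum, Finset.sum_apply]

lemma coe_wirtDer (i) (f : smoothAlg n) : (wirtDer n i f : En n → ℂ) = wirtOp n i f := by
  rcases i with i | i <;> rfl

lemma coe_polDer (i) (f : smoothAlg n) : (polDer n i f : En n → ℂ) = polarOp n i f := by
  ext z
  rcases i with _ | _ | i | i
  · simp [polDer, polarDer, polarOp, radDer, Nop, eulerDer_apply, Finset.sum_add_distrib]
  · simp [polDer, polarDer, polarOp, fieldDer, Xop0, Rop, eulerDer_apply]
  · simp [polDer, polarDer, polarOp, fieldDer, Xop0, Lop, tangDer]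
  · simp [polDer, polarDer, polarOp, fieldDer, Xop0, Lbarop, tangDer]

lemma coe_opWord {ι : Type*} {D : ι → smoothAlg n → smoothAlg n}
    {O : ι → (En n → ℂ) → En n → ℂ} (h : ∀ i f, (D i f : En n → ℂ) = O i f) (l : List ι)
    (f : smoothAlg n) : ((opWord D l f : smoothAlg n) : En n → ℂ) = opWord O l f := by
  induction l with
  | nil => rfl
  | cons i l ih => rw [opWord_cons, opWord_cons, h, ih]

/-- A function smooth on the unit ball agrees on every smaller ball with a smooth function
on the whole space. -/
lemma exists_eqOn {f : En n → ℂ} (hf : ContDiffOn ℝ (⊤ : ℕ∞) f (Metric.ball 0 1)) {r : ℝ}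
    (hr : r < 1) : ∃ g : smoothAlg n, Set.EqOn f g (Metric.ball 0 r) := by
  rcases le_or_gt r 0 with h | h
  · exact ⟨0, by simp [Metric.ball_eq_empty.2 h]⟩
  let χ : ContDiffBump (0 : En n) := ⟨r, (r + 1) / 2, h, by linarith⟩
  refine ⟨⟨fun z => (χ z : ℂ) * f z, ?_⟩, fun z hz => ?_⟩
  · refine show ContDiff ℝ (⊤ : ℕ∞) fun z => (χ z : ℂ) * f z from
      contDiff_iff_contDiffAt.2 fun z => ?_
    by_cases hz' : z ∈ tsupport χ
    swap
    · refine (contDiffAt_const (c := 0)).congr_of_eventuallyEq ?_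
      filter_upwards [notMem_tsupport_iff_eventuallyEq.1 hz'] with w hw
      simp [hw]
    rw [χ.tsupport_eq, mem_closedBall_zero_iff] at hz'
    have h1 : z ∈ Metric.ball (0 : En n) 1 := by
      rw [mem_ball_zero_iff]
      exact lt_of_le_of_lt hz' (show (r + 1) / 2 < 1 by linarith)
    exact (Complex.ofRealCLM.contDiff.comp χ.contDiff).contDiffAt.mul
      (hf.contDiffAt (Metric.isOpen_ball.mem_nhds h1))
  · simp [χ.one_of_mem_closedBall (Metric.ball_subset_closedBall hz)]

end smoothAlg

end Operators

section WeightedNorm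

variable {n : ℕ} {s : ℝ} {V W : Set (En n)}

/-- The squared weighted norm `∫_V |f|² dμ_s`. -/
noncomputable def nsqOn (n : ℕ) (s : ℝ) (V : Set (En n)) (f : En n → ℂ) : ℝ≥0∞ :=
  ∫⁻ z in V, ENNReal.ofReal (poch (s + 1) n / Real.pi ^ n * (1 - ‖z‖ ^ 2) ^ s * ‖f z‖ ^ 2)

lemma poch_pos {a : ℝ} (ha : 0 < a) (k : ℕ) : 0 < poch a k :=
  div_pos (Real.Gamma_pos_of_pos (by positivity)) (Real.Gamma_pos_of_pos ha)

lemma weight_pos (hs : -1 < s) {z : En n} (hz : z ∈ Metric.ball (0 : En n) 1) :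
    0 < poch (s + 1) n / Real.pi ^ n * (1 - ‖z‖ ^ 2) ^ s := by
  rw [mem_ball_zero_iff] at hz
  have : 0 < 1 - ‖z‖ ^ 2 := by nlinarith [norm_nonneg z]
  have := poch_pos (show 0 < s + 1 by linarith) n
  positivity

lemma nsqOn_mono_set (h : V ⊆ W) (f : En n → ℂ) : nsqOn n s V f ≤ nsqOn n s W f :=
  lintegral_mono_set h

lemma nsqOn_congr (hV : MeasurableSet V) {f g : En n → ℂ} (h : Set.EqOn f g V) :
    nsqOn n s V f = nsqOn n s V g :=
  setLIntegral_congr_fun hV fun z hz => by simp only [h hz]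

lemma nsqOn_le_of_norm_le (hs : -1 < s) (hV : MeasurableSet V) (hV' : V ⊆ Metric.ball 0 1)
    {f g : En n → ℂ} {K : ℝ} (h : ∀ z ∈ V, ‖f z‖ ≤ K * ‖g z‖) :
    nsqOn n s V f ≤ ENNReal.ofReal (K ^ 2) * nsqOn n s V g := by
  rw [nsqOn, nsqOn, ← lintegral_const_mul' _ _ ENNReal.ofReal_ne_top]
  refine setLIntegral_mono' hV fun z hz => ?_
  have hw := weight_pos hs (hV' hz)
  rw [← ENNReal.ofReal_mul (sq_nonneg K)]
  refine ENNReal.ofReal_le_ofReal ?_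
  calc _ ≤ _ * (K * ‖g z‖) ^ 2 := by gcongr; exact h z hz
    _ = _ := by ring

lemma nsqOn_add_le (hs : -1 < s) (hV : MeasurableSet V) (hV' : V ⊆ Metric.ball 0 1)
    {f : En n → ℂ} (hf : Measurable f) (g : En n → ℂ) :
    nsqOn n s V (f + g) ≤ 2 * (nsqOn n s V f + nsqOn n s V g) := by
  rw [nsqOn, nsqOn, nsqOn, ← lintegral_add_left (by fun_prop),
    ← lintegral_const_mul' _ _ (by simp)]
  refine setLIntegral_mono' hV fun z hz => ?_
  have hw := weight_pos hs (hV' hz)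
  rw [← ENNReal.ofReal_add (by positivity) (by positivity)]
  have h₂ (a : ℝ) : 2 * ENNReal.ofReal a = ENNReal.ofReal (2 * a) := by
    rw [ENNReal.ofReal_mul zero_le_two, ENNReal.ofReal_ofNat]
  rw [h₂]
  refine ENNReal.ofReal_le_ofReal ?_
  have h₁ : ‖f z + g z‖ ^ 2 ≤ 2 * (‖f z‖ ^ 2 + ‖g z‖ ^ 2) := by
    have := norm_add_le (f z) (g z)
    nlinarith [norm_nonneg (f z + g z), sq_nonneg (‖f z‖ - ‖g z‖)]
  calc _ ≤ _ * (2 * (‖f z‖ ^ 2 + ‖g z‖ ^ 2)) := by gcongr; exact h₁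
    _ = _ := by ring

/-- A bound on all smaller balls gives a bound on the unit ball. -/
lemma nsqOn_le_of_forall_inter_ball (hV : V ⊆ Metric.ball 0 1) {f : En n → ℂ} {B : ℝ≥0∞}
    (h : ∀ r < 1, nsqOn n s (V ∩ Metric.ball 0 r) f ≤ B) : nsqOn n s V f ≤ B := by
  have hU : V = ⋃ k : ℕ, V ∩ Metric.ball 0 (1 - 1 / ((k : ℝ) + 1)) := by
    rw [← Set.inter_iUnion]
    refine (Set.inter_eq_left.2 fun z hz => ?_).symm
    have hz := hV hz
    rw [mem_ball_zero_iff] at hz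
    obtain ⟨k, hk⟩ := exists_nat_one_div_lt (sub_pos.2 hz)
    exact Set.mem_iUnion.2 ⟨k, by rw [mem_ball_zero_iff]; linarith⟩
  have hmono : Monotone fun k : ℕ => V ∩ Metric.ball (0 : En n) (1 - 1 / ((k : ℝ) + 1)) := by
    intro k l hkl
    refine Set.inter_subset_inter_right _ (Metric.ball_subset_ball ?_)
    gcongr
  rw [hU, nsqOn, setLIntegral_iUnion_of_directed _ hmono.directed_le]
  exact iSup_le fun k => h _ (sub_lt_self _ (by positivity))

lemma exists_nsqOn_le_of_mem_wordSpan (hs : -1 < s) {ι : Type*}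
    (D : ι → Derivation ℂ (smoothAlg n) (smoothAlg n)) {m : ℕ} {P : smoothAlg n → smoothAlg n}
    (hP : P ∈ wordSpan D m) :
    ∃ K : ℝ≥0∞, K ≠ ⊤ ∧ ∀ V : Set (En n), MeasurableSet V → V ⊆ Metric.ball 0 1 →
      ∀ (f : smoothAlg n) (B : ℝ≥0∞),
        (∀ l : List ι, l.length ≤ m → nsqOn n s V (opWord (fun i => D i) l f : smoothAlg n) ≤ B) →
        nsqOn n s V (P f : smoothAlg n) ≤ K * B := by
  induction hP using Submodule.span_induction with
  | mem P h =>
    obtain ⟨l, hl, rfl⟩ := h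
    exact ⟨1, by simp, fun V _ _ f B hB => by simpa using hB l hl⟩
  | zero =>
    exact ⟨0, by simp, fun V _ _ f B hB => by simp [nsqOn]⟩
  | add P Q _ _ hP hQ =>
    obtain ⟨K, hK, hKP⟩ := hP
    obtain ⟨L, hL, hLQ⟩ := hQ
    refine ⟨2 * (K + L), by finiteness, fun V hV hV' f B hB => ?_⟩
    calc nsqOn n s V ((P f : En n → ℂ) + (Q f : En n → ℂ))
        ≤ 2 * (nsqOn n s V (P f) + nsqOn n s V (Q f)) :=
          nsqOn_add_le hs hV hV' (smoothAlg.continuous _).measurable _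
      _ ≤ 2 * (K * B + L * B) := by gcongr; exacts [hKP V hV hV' f B hB, hLQ V hV hV' f B hB]
      _ = _ := by ring
  | smul a P _ hP =>
    obtain ⟨K, hK, hKP⟩ := hP
    obtain ⟨M, hM⟩ := (isCompact_closedBall (0 : En n) 1).exists_bound_of_continuousOn
      (smoothAlg.continuous a).continuousOn
    refine ⟨ENNReal.ofReal (M ^ 2) * K, by finiteness, fun V hV hV' f B hB => ?_⟩
    calc nsqOn n s V ((a • P) f : smoothAlg n)
        ≤ ENNReal.ofReal (M ^ 2) * nsqOn n s V (P f) :=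
          nsqOn_le_of_norm_le hs hV hV' fun z hz => by
            simp only [Pi.smul_apply, smul_eq_mul, MulMemClass.coe_mul, Pi.mul_apply, norm_mul]
            gcongr
            exact hM z (Metric.ball_subset_closedBall (hV' hz))
      _ ≤ _ := by rw [mul_assoc]; gcongr; exact hKP V hV hV' f B hB

end WeightedNorm

section IntegrationByParts

variable {n : ℕ}

instance isAddHaarMeasure_volume (n : ℕ) : (volume : Measure (En n)).IsAddHaarMeasure :=
  ContinuousLinearEquiv.isAddHaarMeasure_map
    (PiLp.continuousLinearEquiv 2 ℝ (fun _ : Fin n => ℂ)).symm volume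

namespace smoothAlg

/-- The operator `P` has a local formal transpose. -/
def HasTranspose (P : smoothAlg n → smoothAlg n) : Prop :=
  ∃ T : smoothAlg n → smoothAlg n,
    (∀ a, tsupport (T a : En n → ℂ) ⊆ tsupport (a : En n → ℂ)) ∧
    ∀ a b : smoothAlg n, HasCompactSupport (a : En n → ℂ) →
      ∫ z, (a : En n → ℂ) z * (P b : En n → ℂ) z = ∫ z, (T a : En n → ℂ) z * (b : En n → ℂ) z

lemma integrable_mul {a : smoothAlg n} (ha : HasCompactSupport (a : En n → ℂ)) (b : smoothAlg n) :
    Integrable fun z => (a : En n → ℂ) z * (b : En n → ℂ) z :=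
  ((continuous a).mul (continuous b)).integrable_of_hasCompactSupport ha.mul_right

namespace HasTranspose

variable {P Q : smoothAlg n → smoothAlg n}

lemma dirDer (v : En n) : HasTranspose (dirDer v : smoothAlg n → smoothAlg n) := by
  have hsupp (a : smoothAlg n) : tsupport (smoothAlg.dirDer v a : En n → ℂ) ⊆
      tsupport (a : En n → ℂ) :=
    tsupport_fderiv_apply_subset ℝ v
  refine ⟨fun a => -smoothAlg.dirDer v a, fun a => ?_, fun a b ha => ?_⟩
  · refine subset_trans (closure_mono ?_) (hsupp a)
    intro z hz
    simpa using hz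
  · have ha' : HasCompactSupport (smoothAlg.dirDer v a : En n → ℂ) :=
      ha.of_isClosed_subset (isClosed_tsupport _) (hsupp a)
    have := integral_mul_fderiv_eq_neg_fderiv_mul_of_integrable (v := v)
      (integrable_mul ha' b) (integrable_mul ha (smoothAlg.dirDer v b)) (integrable_mul ha b)
      (fun z _ => (differentiable a).differentiableAt)
      (fun z _ => (differentiable b).differentiableAt)
    simpa [dirDer_apply, integral_neg] using this

lemma add (hP : HasTranspose P) (hQ : HasTranspose Q) : HasTranspose fun f => P f + Q f := by
  obtain ⟨T, hT, hPT⟩ := hP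
  obtain ⟨U, hU, hQU⟩ := hQ
  refine ⟨fun a => T a + U a,
    fun a => (tsupport_add _ _).trans (Set.union_subset (hT a) (hU a)), fun a b ha => ?_⟩
  have h₁ : HasCompactSupport (T a : En n → ℂ) :=
    ha.of_isClosed_subset (isClosed_tsupport _) (hT a)
  have h₂ : HasCompactSupport (U a : En n → ℂ) :=
    ha.of_isClosed_subset (isClosed_tsupport _) (hU a)
  simp only [Subalgebra.coe_add, Pi.add_apply, mul_add, add_mul]
  rw [integral_add (integrable_mul ha _) (integrable_mul ha _), hPT a b ha, hQU a b ha,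
    integral_add (integrable_mul h₁ _) (integrable_mul h₂ _)]

lemma mul_left (c : smoothAlg n) (hP : HasTranspose P) : HasTranspose fun f => c * P f := by
  obtain ⟨T, hT, hPT⟩ := hP
  have h (a : smoothAlg n) :
      tsupport ((c * a : smoothAlg n) : En n → ℂ) ⊆ tsupport (a : En n → ℂ) :=
    tsupport_mul_subset_right
  refine ⟨fun a => T (c * a), fun a => (hT _).trans (h a), fun a b ha => ?_⟩
  rw [← hPT (c * a) b (ha.of_isClosed_subset (isClosed_tsupport _) (h a))]
  refine integral_congr_ae (Filter.Eventually.of_forall fun z => ?_)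
  simp only [MulMemClass.coe_mul, Pi.mul_apply]
  ring

lemma comp (hP : HasTranspose P) (hQ : HasTranspose Q) : HasTranspose fun f => P (Q f) := by
  obtain ⟨T, hT, hPT⟩ := hP
  obtain ⟨U, hU, hQU⟩ := hQ
  refine ⟨fun a => U (T a), fun a => (hU _).trans (hT a), fun a b ha => ?_⟩
  rw [hPT a _ ha, hQU _ b (ha.of_isClosed_subset (isClosed_tsupport _) (hT a))]

lemma zero : HasTranspose fun _ : smoothAlg n => 0 :=
  ⟨fun _ => 0, fun a => by simp [tsupport], fun a b _ => by simp⟩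

lemma sum {ι : Type*} (t : Finset ι) {P : ι → smoothAlg n → smoothAlg n}
    (hP : ∀ i, HasTranspose (P i)) : HasTranspose fun f => ∑ i ∈ t, P i f := by
  classical
  induction t using Finset.induction_on with
  | empty => simpa using zero
  | insert i t hi ih => simpa only [Finset.sum_insert hi] using (hP i).add ih

lemma const_smul (c : ℂ) (hP : HasTranspose P) : HasTranspose fun f => c • P f := by
  simpa only [Algebra.smul_def] using hP.mul_left (algebraMap ℂ (smoothAlg n) c)

lemma dz (j : Fin n) : HasTranspose (dz j : smoothAlg n → smoothAlg n) := by
  have h := ((dirDer (EuclideanSpace.single j 1)).add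
    ((dirDer (EuclideanSpace.single j Complex.I)).const_smul (-Complex.I))).const_smul (1 / 2)
  convert h using 2 with f
  simp [smoothAlg.dz, sub_eq_add_neg]

lemma dzb (j : Fin n) : HasTranspose (dzb j : smoothAlg n → smoothAlg n) := by
  have h := ((dirDer (EuclideanSpace.single j 1)).add
    ((dirDer (EuclideanSpace.single j Complex.I)).const_smul Complex.I)).const_smul (1 / 2)
  convert h using 2 with f
  simp [smoothAlg.dzb]

end HasTranspose

/-- The operator `Σ_{j,k} (δ_{jk} - z_j z̄_k) ∂²/∂z_j∂z̄_k`. -/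
noncomputable def lap (n : ℕ) : smoothAlg n → smoothAlg n :=
  mobLap dz dzb coord fun j => conj (coord j)

lemma hasTranspose_lap : HasTranspose (lap n) := by
  have hE : HasTranspose (eulerDer (dz (n := n)) coord) := by
    rw [show ⇑(eulerDer (dz (n := n)) coord) = _ from funext (eulerDer_apply _ _)]
    exact HasTranspose.sum Finset.univ fun j => (HasTranspose.dz j).mul_left (coord j)
  have hE' : HasTranspose (eulerDer (dzb (n := n)) fun j => conj (coord j)) := by
    rw [show ⇑(eulerDer (dzb (n := n)) fun j => conj (coord j)) = _ from
      funext (eulerDer_apply _ _)]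
    exact HasTranspose.sum Finset.univ fun j => (HasTranspose.dzb j).mul_left (conj (coord j))
  have h := (HasTranspose.sum Finset.univ fun j : Fin n =>
    (HasTranspose.dz j).comp (HasTranspose.dzb j)).add ((hE.comp hE').const_smul (-1))
  convert h using 2 with f
  simp [lap, mobLap, sub_eq_add_neg]

end smoothAlg

end IntegrationByParts

section Caccioppoli

variable {n : ℕ}

lemma mobLap_mul {S ι : Type*} [CommRing S] [Algebra ℂ S] [Fintype ι]
    (d e : ι → Derivation ℂ S S) (x y : ι → S) (f g : S) :
    mobLap d e x y (f * g) = f * mobLap d e x y g + g * mobLap d e x y f +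
      (∑ j, (d j f * e j g + e j f * d j g) -
        (eulerDer d x f * eulerDer e y g + eulerDer e y f * eulerDer d x g)) := by
  have (j : ι) : d j (e j (f * g)) =
      f * d j (e j g) + g * d j (e j f) + (d j f * e j g + e j f * d j g) := by
    simp only [Derivation.leibniz, smul_eq_mul, map_add]
    ring
  simp only [mobLap, this, Finset.sum_add_distrib, ← Finset.mul_sum]
  simp only [Derivation.leibniz, smul_eq_mul, map_add]
  ring

namespace smoothAlg

@[simp] lemma conj_add (f g : smoothAlg n) : conj (f + g) = conj f + conj g := by ext; simp

@[simp] lemma conj_mul (f g : smoothAlg n) : conj (f * g) = conj f * conj g := by ext; simp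

@[simp] lemma conj_sub (f g : smoothAlg n) : conj (f - g) = conj f - conj g := by ext; simp

@[simp] lemma conj_conj (f : smoothAlg n) : conj (conj f) = f := by ext; simp

@[simp] lemma conj_sum {ι : Type*} (t : Finset ι) (f : ι → smoothAlg n) :
    conj (∑ i ∈ t, f i) = ∑ i ∈ t, conj (f i) := by ext; simp

lemma eulerDer_dzb_conj (f : smoothAlg n) :
    eulerDer (dzb (n := n)) (fun j => conj (coord j)) (conj f) =
      conj (eulerDer (dz (n := n)) coord f) := by
  simp [eulerDer_apply, dzb_conj]

lemma eulerDer_dz_conj (f : smoothAlg n) :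
    eulerDer (dz (n := n)) coord (conj f) =
      conj (eulerDer (dzb (n := n)) (fun j => conj (coord j)) f) := by
  simp [eulerDer_apply, dz_conj]

lemma lap_conj (f : smoothAlg n) : lap n (conj f) = conj (lap n f) := by
  rw [lap, ← (wirtingerSystem n).mobLap_symm f]
  simp [mobLap, dzb_conj, dz_conj, eulerDer_dzb_conj, eulerDer_dz_conj]

lemma norm_eulerDer_sq_le (z : En n) (w a : Fin n → ℂ) (hw : ∀ j, ‖w j‖ = ‖z j‖) :
    ‖∑ j, w j * a j‖ ^ 2 ≤ ‖z‖ ^ 2 * ∑ j, ‖a j‖ ^ 2 := by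
  calc ‖∑ j, w j * a j‖ ^ 2 ≤ (∑ j, ‖w j‖ * ‖a j‖) ^ 2 := by
        gcongr
        exact (norm_sum_le _ _).trans_eq (by simp)
    _ ≤ _ := by
        rw [EuclideanSpace.norm_sq_eq]
        simpa only [hw] using Finset.sum_mul_sq_le_sq_mul_sq Finset.univ (fun j => ‖w j‖)
          fun j => ‖a j‖

lemma gradient_le_lap (g : smoothAlg n) {z : En n} (h : (lap n g : En n → ℂ) z = 0) :
    (1 - ‖z‖ ^ 2) * ∑ i, ‖(wirtDer n i g : En n → ℂ) z‖ ^ 2 ≤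
      ((lap n (g * conj g) : En n → ℂ) z).re := by
  have hl : ((lap n (g * conj g) : En n → ℂ) z).re =
      ∑ i, ‖(wirtDer n i g : En n → ℂ) z‖ ^ 2 -
        (‖∑ j, z j * (dz j g : En n → ℂ) z‖ ^ 2 +
          ‖∑ j, starRingEnd ℂ (z j) * (dzb j g : En n → ℂ) z‖ ^ 2) := by
    have h0 := mobLap_mul dz dzb coord (fun j => conj (coord j)) g (conj g)
    rw [eulerDer_dzb_conj, eulerDer_dz_conj, ← lap, lap_conj] at h0
    have h1 := congrArg (fun f : smoothAlg n => ((f : En n → ℂ) z).re) h0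
    simp only [dzb_conj, dz_conj, Subalgebra.coe_add, Subalgebra.coe_sub, Subalgebra.coe_mul,
      Pi.add_apply, Pi.sub_apply, Pi.mul_apply, conj_apply, coe_sum_apply, Complex.mul_conj, h,
      eulerDer_apply, coord_apply, Complex.normSq_eq_norm_sq] at h1
    rw [h1, Fintype.sum_sum_type]
    simp [wirtDer, Finset.sum_add_distrib, -Complex.ofReal_pow, -coe_dz, -coe_dzb]
  have h₁ := norm_eulerDer_sq_le z (fun j => z j) (fun j => (dz j g : En n → ℂ) z) fun _ => rfl
  have h₂ := norm_eulerDer_sq_le z (fun j => starRingEnd ℂ (z j))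
    (fun j => (dzb j g : En n → ℂ) z) fun _ => by simp
  rw [hl, Fintype.sum_sum_type]
  simp only [wirtDer, Sum.elim_inl, Sum.elim_inr]
  linarith

/-- The gradient of an M-harmonic function on a ball is controlled by the function
on a larger ball. -/
lemma exists_integral_sq_wirtDer_le {r R : ℝ} (hr : 0 < r) (hrR : r < R) (hR : R < 1) :
    ∃ K : ℝ, ∀ (g : smoothAlg n) (i : Fin n ⊕ Fin n),
      (∀ z ∈ Metric.ball (0 : En n) R, (lap n g : En n → ℂ) z = 0) →
      ∫ z in Metric.ball (0 : En n) r, ‖(wirtDer n i g : En n → ℂ) z‖ ^ 2 ≤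
        K * ∫ z in Metric.ball (0 : En n) R, ‖(g : En n → ℂ) z‖ ^ 2 := by
  obtain ⟨T, hT, hlap⟩ := hasTranspose_lap (n := n)
  let χ : ContDiffBump (0 : En n) := ⟨r, (r + R) / 2, hr, by linarith⟩
  let φ : smoothAlg n := ⟨fun z => (χ z : ℂ), show ContDiff ℝ (⊤ : ℕ∞) fun z => (χ z : ℂ) from
    Complex.ofRealCLM.contDiff.comp χ.contDiff⟩
  have hsupp : tsupport (φ : En n → ℂ) ⊆ Metric.closedBall 0 ((r + R) / 2) := by
    refine subset_trans (closure_mono fun z hz => ?_) χ.tsupport_eq.subset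
    simpa [φ] using hz
  have hsuppR : tsupport (φ : En n → ℂ) ⊆ Metric.ball 0 R :=
    hsupp.trans (Metric.closedBall_subset_ball (by linarith))
  have hφ : HasCompactSupport (φ : En n → ℂ) :=
    (isCompact_closedBall (0 : En n) ((r + R) / 2)).of_isClosed_subset (isClosed_tsupport _) hsupp
  have hψ : HasCompactSupport (T φ : En n → ℂ) :=
    hφ.of_isClosed_subset (isClosed_tsupport _) (hT φ)
  obtain ⟨M, hM⟩ := hψ.exists_bound_of_continuous (continuous (T φ))
  have hint (f : smoothAlg n) (t : ℝ) :
      IntegrableOn (fun z => ‖(f : En n → ℂ) z‖ ^ 2) (Metric.ball (0 : En n) t) :=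
    (((continuous f).norm.pow 2).continuousOn.integrableOn_compact
      (isCompact_closedBall (0 : En n) t)).mono_set Metric.ball_subset_closedBall
  refine ⟨M / (1 - r ^ 2), fun g i hg => ?_⟩
  have hr1 : 0 < 1 - r ^ 2 := by nlinarith
  have hub : IntegrableOn (fun z => M * ‖(g : En n → ℂ) z‖ ^ 2) (Metric.ball (0 : En n) R) :=
    (hint g R).const_mul M
  have hφL : Integrable fun z => χ z * ((lap n (g * conj g) : En n → ℂ) z).re := by
    simpa [φ] using (integrable_mul hφ (lap n (g * conj g))).re
  have key : ∫ z, χ z * ((lap n (g * conj g) : En n → ℂ) z).re ≤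
      ∫ z in Metric.ball (0 : En n) R, M * ‖(g : En n → ℂ) z‖ ^ 2 := by
    have h₁ : ∫ z, χ z * ((lap n (g * conj g) : En n → ℂ) z).re =
        (∫ z, (T φ : En n → ℂ) z * ((g * conj g : smoothAlg n) : En n → ℂ) z).re := by
      rw [← hlap φ _ hφ]
      have := integral_re (integrable_mul hφ (lap n (g * conj g)))
      simpa [φ] using this
    rw [h₁]
    refine (Complex.re_le_norm _).trans ?_
    rw [← setIntegral_eq_integral_of_forall_compl_eq_zero (s := Metric.ball (0 : En n) R)]
    · refine norm_integral_le_of_norm_le hub (Filter.Eventually.of_forall fun z => ?_)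
      simp only [Subalgebra.coe_mul, Pi.mul_apply, conj_apply, norm_mul, RCLike.norm_conj, ← sq]
      gcongr
      exact hM z
    · intro z hz
      rw [image_eq_zero_of_notMem_tsupport fun h => hz (hsuppR (hT φ h)), zero_mul]
  have lower : (1 - r ^ 2) * ∫ z in Metric.ball (0 : En n) r, ‖(wirtDer n i g : En n → ℂ) z‖ ^ 2 ≤
      ∫ z, χ z * ((lap n (g * conj g) : En n → ℂ) z).re := by
    have hgrad (z : En n) (hz : z ∈ Metric.ball (0 : En n) R) :
        0 ≤ 1 - ‖z‖ ^ 2 ∧ (1 - ‖z‖ ^ 2) * ‖(wirtDer n i g : En n → ℂ) z‖ ^ 2 ≤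
          ((lap n (g * conj g) : En n → ℂ) z).re := by
      have hz' := mem_ball_zero_iff.1 hz
      have h0 : 0 ≤ 1 - ‖z‖ ^ 2 := by nlinarith [norm_nonneg z]
      refine ⟨h0, le_trans ?_ (gradient_le_lap g (hg z hz))⟩
      gcongr
      exact Finset.single_le_sum (f := fun i => ‖(wirtDer n i g : En n → ℂ) z‖ ^ 2)
        (fun _ _ => sq_nonneg _) (Finset.mem_univ i)
    rw [← integral_const_mul]
    calc _ ≤ ∫ z in Metric.ball (0 : En n) r, χ z * ((lap n (g * conj g) : En n → ℂ) z).re := by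
          refine setIntegral_mono_on ((hint _ r).const_mul _) hφL.integrableOn
            Metric.isOpen_ball.measurableSet fun z hz => ?_
          rw [χ.one_of_mem_closedBall (Metric.ball_subset_closedBall hz), one_mul]
          refine le_trans ?_ (hgrad z (Metric.ball_subset_ball hrR.le hz)).2
          have hz' := mem_ball_zero_iff.1 hz
          gcongr
      _ ≤ _ := by
          refine setIntegral_le_integral hφL (Filter.Eventually.of_forall fun z => ?_)
          by_cases hz : z ∈ Metric.ball (0 : En n) R
          · obtain ⟨h0, h1⟩ := hgrad z hz
            exact mul_nonneg χ.nonneg (le_trans (mul_nonneg h0 (sq_nonneg _)) h1)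
          · have : (φ : En n → ℂ) z = 0 := image_eq_zero_of_notMem_tsupport fun h => hz (hsuppR h)
            simp [Complex.ofReal_eq_zero.1 (show (χ z : ℂ) = 0 from this)]
  rw [integral_const_mul] at key
  rw [div_mul_eq_mul_div, le_div_iff₀ hr1, mul_comm]
  exact lower.trans key

end smoothAlg

end Caccioppoli

lemma mobFam_mem_span {S ι : Type*} [CommRing S] [Algebra ℂ S] [Fintype ι]
    (d e : ι → Derivation ℂ S S) (x y : ι → S) (i : ι ⊕ ι) :
    mobFam d e x y i ∈ Submodule.span S (Set.range (Sum.elim d e)) := by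
  rcases i with i | i
  · exact sub_mem (Submodule.subset_span ⟨Sum.inl i, rfl⟩)
      (Submodule.smul_mem _ _ (eulerDer_mem_span' d e y))
  · exact sub_mem (Submodule.subset_span ⟨Sum.inr i, rfl⟩)
      (Submodule.smul_mem _ _ (eulerDer_mem_span d e x))

section InteriorEstimates

variable {n : ℕ} {s : ℝ}

/-- On a smaller ball the weights for different parameters are comparable. -/
lemma exists_nsqOn_le_nsqOn {s' : ℝ} (hs' : -1 < s') {ρ : ℝ} (hρ : ρ < 1) :
    ∃ K : ℝ≥0∞, K ≠ ⊤ ∧ ∀ V : Set (En n), MeasurableSet V → V ⊆ Metric.ball 0 ρ →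
      ∀ f : En n → ℂ, nsqOn n s V f ≤ K * nsqOn n s' V f := by
  let w (t : ℝ) (z : En n) : ℝ := poch (t + 1) n / Real.pi ^ n * (1 - ‖z‖ ^ 2) ^ t
  have hball : Metric.closedBall (0 : En n) ρ ⊆ Metric.ball 0 1 :=
    Metric.closedBall_subset_ball hρ
  have hcont (t : ℝ) : ContinuousOn (w t) (Metric.closedBall 0 ρ) := by
    refine continuousOn_const.mul (ContinuousOn.rpow_const (by fun_prop) fun z hz => Or.inl ?_)
    have := mem_ball_zero_iff.1 (hball hz)
    nlinarith [norm_nonneg z]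
  obtain ⟨M, hM⟩ := (isCompact_closedBall (0 : En n) ρ).exists_bound_of_continuousOn
    ((hcont s).div (hcont s') fun z hz => (weight_pos hs' (hball hz)).ne')
  refine ⟨ENNReal.ofReal M, ENNReal.ofReal_ne_top, fun V hV hVρ f => ?_⟩
  rw [nsqOn, nsqOn, ← lintegral_const_mul' _ _ ENNReal.ofReal_ne_top]
  refine setLIntegral_mono' hV fun z hz => ?_
  have hz' := Metric.ball_subset_closedBall (hVρ hz)
  have hw := weight_pos hs' (hball hz')
  have hle : w s z ≤ M * w s' z := (div_le_iff₀ hw).1 ((Real.le_norm_self _).trans (hM z hz'))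
  have hM0 : 0 ≤ M := (norm_nonneg _).trans (hM z hz')
  rw [← ENNReal.ofReal_mul hM0]
  refine ENNReal.ofReal_le_ofReal ?_
  calc w s z * ‖f z‖ ^ 2 ≤ M * w s' z * ‖f z‖ ^ 2 := by gcongr
    _ = _ := by ring

lemma nsqOn_zero_ball (f : smoothAlg n) (r : ℝ) :
    nsqOn n 0 (Metric.ball 0 r) f = ENNReal.ofReal (poch (0 + 1) n / Real.pi ^ n) *
      ENNReal.ofReal (∫ z in Metric.ball (0 : En n) r, ‖(f : En n → ℂ) z‖ ^ 2) := by
  have hint : IntegrableOn (fun z => ‖(f : En n → ℂ) z‖ ^ 2) (Metric.ball (0 : En n) r) :=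
    (((smoothAlg.continuous f).norm.pow 2).continuousOn.integrableOn_compact
      (isCompact_closedBall (0 : En n) r)).mono_set Metric.ball_subset_closedBall
  have hpos : 0 ≤ poch (0 + 1) n / Real.pi ^ n :=
    div_nonneg (poch_pos (by norm_num) n).le (by positivity)
  rw [ofReal_integral_eq_lintegral_ofReal hint (Filter.Eventually.of_forall fun z => sq_nonneg _),
    ← lintegral_const_mul' _ _ ENNReal.ofReal_ne_top]
  simp only [nsqOn, Real.rpow_zero, mul_one, ENNReal.ofReal_mul hpos]

lemma exists_nsqOn_wirtDer_le (hs : -1 < s) {r R : ℝ} (hr : 0 < r) (hrR : r < R) (hR : R < 1) :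
    ∃ K : ℝ≥0∞, K ≠ ⊤ ∧ ∀ (g : smoothAlg n) (i : Fin n ⊕ Fin n),
      (∀ z ∈ Metric.ball (0 : En n) R, (smoothAlg.lap n g : En n → ℂ) z = 0) →
      nsqOn n s (Metric.ball 0 r) (smoothAlg.wirtDer n i g) ≤
        K * nsqOn n s (Metric.ball 0 R) g := by
  obtain ⟨K, hK⟩ := smoothAlg.exists_integral_sq_wirtDer_le (n := n) hr hrR hR
  obtain ⟨K₁, hK₁, h₁⟩ := exists_nsqOn_le_nsqOn (n := n) (s := s) (s' := 0) (by norm_num) hR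
  obtain ⟨K₂, hK₂, h₂⟩ := exists_nsqOn_le_nsqOn (n := n) (s := 0) hs hR
  refine ⟨K₁ * (ENNReal.ofReal K * K₂), by finiteness, fun g i hg => ?_⟩
  calc _ ≤ K₁ * nsqOn n 0 (Metric.ball 0 r) (smoothAlg.wirtDer n i g) :=
        h₁ _ Metric.isOpen_ball.measurableSet (Metric.ball_subset_ball hrR.le) _
    _ ≤ K₁ * (ENNReal.ofReal K * nsqOn n 0 (Metric.ball 0 R) g) := by
        gcongr
        have h := ENNReal.ofReal_le_ofReal (hK g i hg)
        rw [ENNReal.ofReal_mul' (integral_nonneg fun z => sq_nonneg _)] at h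
        rw [nsqOn_zero_ball, nsqOn_zero_ball, mul_left_comm]
        gcongr
    _ ≤ K₁ * (ENNReal.ofReal K * (K₂ * nsqOn n s (Metric.ball 0 R) g)) := by
        gcongr
        exact h₂ _ Metric.isOpen_ball.measurableSet le_rfl _
    _ = _ := by ring

namespace smoothAlg

/-- The infinitesimal automorphisms of the ball and their conjugates. -/
noncomputable def autDer (n : ℕ) : Fin n ⊕ Fin n → Derivation ℂ (smoothAlg n) (smoothAlg n) :=
  mobFam dz dzb coord fun j => conj (coord j)

lemma autDer_mem_span (i) :
    autDer n i ∈ Submodule.span (smoothAlg n) (Set.range (wirtDer n)) :=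
  mobFam_mem_span dz dzb coord (fun j => conj (coord j)) i

lemma lap_autDer (i) (f : smoothAlg n) :
    ∃ a : smoothAlg n, lap n (autDer n i f) = autDer n i (lap n f) - a * lap n f := by
  rcases i with i | i
  · exact ⟨_, (wirtingerSystem n).mobLap_mobDer i f⟩
  · refine ⟨coord i, ?_⟩
    have h := (wirtingerSystem n).symm.mobLap_mobDer i f
    rwa [(wirtingerSystem n).mobLap_symm, (wirtingerSystem n).mobLap_symm] at h

/-- A derivation is a local operator. -/
lemma autDer_eq_zero {V : Set (En n)} (hV : IsOpen V) (i) {f : smoothAlg n}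
    (hf : ∀ z ∈ V, (f : En n → ℂ) z = 0) : ∀ z ∈ V, (autDer n i f : En n → ℂ) z = 0 := by
  intro z hz
  have h0 i : (wirtDer n i f : En n → ℂ) z = 0 := by
    rw [coe_wirtDer, wirtOp_eqOn hV i f (0 : smoothAlg n) hf hz, ← coe_wirtDer, map_zero]
    rfl
  have h := autDer_mem_span i
  generalize autDer n i = E at h ⊢
  induction h using Submodule.span_induction with
  | mem E h => obtain ⟨j, rfl⟩ := h; exact h0 j
  | zero => rfl
  | add E F _ _ hE hF => simp [hE, hF]
  | smul a E _ hE => simp [hE]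

lemma lap_opWord_autDer_eq_zero {V : Set (En n)} (hV : IsOpen V) (l : List (Fin n ⊕ Fin n))
    {f : smoothAlg n} (hf : ∀ z ∈ V, (lap n f : En n → ℂ) z = 0) :
    ∀ z ∈ V, (lap n (opWord (fun i => autDer n i) l f) : En n → ℂ) z = 0 := by
  induction l with
  | nil => exact hf
  | cons i l ih =>
    intro z hz
    obtain ⟨a, ha⟩ := lap_autDer i (opWord (fun i => autDer n i) l f)
    rw [opWord_cons, ha]
    simp [autDer_eq_zero hV i ih z hz, ih z hz]

end smoothAlg

open smoothAlg

lemma exists_nsqOn_autDer_le (hs : -1 < s) (i : Fin n ⊕ Fin n) {r R : ℝ} (hr : 0 < r)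
    (hrR : r < R) (hR : R < 1) :
    ∃ K : ℝ≥0∞, K ≠ ⊤ ∧ ∀ g : smoothAlg n,
      (∀ z ∈ Metric.ball (0 : En n) R, (lap n g : En n → ℂ) z = 0) →
      nsqOn n s (Metric.ball 0 r) (autDer n i g) ≤ K * nsqOn n s (Metric.ball 0 R) g := by
  obtain ⟨K₁, hK₁, h₁⟩ := exists_nsqOn_wirtDer_le (n := n) hs hr hrR hR
  obtain ⟨K₂, hK₂, h₂⟩ := exists_nsqOn_le_of_mem_wordSpan (n := n) hs (wirtDer n)
    (comp_mem_wordSpan_of_mem_span (wirtDer n) (autDer_mem_span i)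
      (opWord_mem_wordSpan (l := []) (wirtDer n) le_rfl))
  refine ⟨K₂ * (1 + K₁), by finiteness, fun g hg => ?_⟩
  rw [mul_assoc]
  refine h₂ _ Metric.isOpen_ball.measurableSet (Metric.ball_subset_ball (hrR.trans hR).le) g _
    fun l hl => ?_
  rw [add_mul, one_mul]
  match l, hl with
  | [], _ => exact le_add_right (nsqOn_mono_set (Metric.ball_subset_ball hrR.le) _)
  | [j], _ => exact le_add_left (h₁ g j hg)

lemma exists_nsqOn_opWord_autDer_le (hs : -1 < s) (l : List (Fin n ⊕ Fin n)) {r R : ℝ}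
    (hr : 0 < r) (hrR : r < R) (hR : R < 1) :
    ∃ K : ℝ≥0∞, K ≠ ⊤ ∧ ∀ g : smoothAlg n,
      (∀ z ∈ Metric.ball (0 : En n) R, (lap n g : En n → ℂ) z = 0) →
      nsqOn n s (Metric.ball 0 r) (opWord (fun i => autDer n i) l g : smoothAlg n) ≤
        K * nsqOn n s (Metric.ball 0 R) g := by
  induction l generalizing r with
  | nil =>
    exact ⟨1, by simp, fun g _ => by
      simpa using nsqOn_mono_set (Metric.ball_subset_ball hrR.le) _⟩
  | cons i l ih =>
    have hρ : (r + R) / 2 < R := by linarith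
    obtain ⟨K₁, hK₁, h₁⟩ := exists_nsqOn_autDer_le (n := n) hs i hr
      (show r < (r + R) / 2 by linarith) (hρ.trans hR)
    obtain ⟨K₂, hK₂, h₂⟩ := ih (show 0 < (r + R) / 2 by linarith) hρ
    refine ⟨K₁ * K₂, by finiteness, fun g hg => ?_⟩
    refine (h₁ _ (lap_opWord_autDer_eq_zero Metric.isOpen_ball l fun z hz =>
      hg z (Metric.ball_subset_ball hρ.le hz))).trans ?_
    rw [mul_assoc]
    gcongr
    exact h₂ g hg

lemma exists_forall_length_le {ι : Type*} [Finite ι] (m : ℕ) {F : List ι → ℝ≥0∞}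
    (hF : ∀ l, F l ≠ ⊤) : ∃ K : ℝ≥0∞, K ≠ ⊤ ∧ ∀ l, l.length ≤ m → F l ≤ K :=
  ⟨∑ l ∈ (List.finite_length_le ι m).toFinset, F l, ENNReal.sum_ne_top.2 fun l _ => hF l,
    fun l hl => Finset.single_le_sum (fun _ _ => zero_le) (by simpa using hl)⟩

/-- Comparison of words in two families of derivations away from the zeros of `u`. -/
lemma exists_nsqOn_opWord_le (hs : -1 < s) {ι κ : Type*}
    (D : ι → Derivation ℂ (smoothAlg n) (smoothAlg n))
    (E : κ → Derivation ℂ (smoothAlg n) (smoothAlg n)) (u : smoothAlg n)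
    (hE : ∀ k, u • E k ∈ Submodule.span (smoothAlg n) (Set.range D)) {δ : ℝ} (hδ : 0 < δ)
    (l : List κ) :
    ∃ K : ℝ≥0∞, K ≠ ⊤ ∧ ∀ V : Set (En n), MeasurableSet V → V ⊆ Metric.ball 0 1 →
      (∀ z ∈ V, δ ≤ ‖(u : En n → ℂ) z‖) → ∀ (f : smoothAlg n) (B : ℝ≥0∞),
        (∀ l' : List ι, l'.length ≤ l.length →
          nsqOn n s V (opWord (fun i => D i) l' f : smoothAlg n) ≤ B) →
        nsqOn n s V (opWord (fun k => E k) l f : smoothAlg n) ≤ K * B := by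
  obtain ⟨K, hK, h⟩ := exists_nsqOn_le_of_mem_wordSpan (n := n) hs D
    (pow_mul_opWord_mem_wordSpan D E u hE l)
  refine ⟨ENNReal.ofReal (((δ ^ (2 * l.length))⁻¹) ^ 2) * K, by finiteness,
    fun V hV hV' hu f B hB => ?_⟩
  rw [mul_assoc]
  refine (nsqOn_le_of_norm_le hs hV hV' (K := (δ ^ (2 * l.length))⁻¹)
    fun z hz => ?_).trans (mul_le_mul_right (h V hV hV' f B hB) _)
  rw [inv_mul_eq_div, le_div_iff₀ (by positivity), mul_comm]
  simp only [Subalgebra.coe_mul, SubmonoidClass.coe_pow, Pi.mul_apply, Pi.pow_apply, norm_mul,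
    norm_pow]
  gcongr
  exact hu z hz

lemma sum_coord_mul_conj_apply (z : En n) :
    ((∑ j, coord j * conj (coord j) : smoothAlg n) : En n → ℂ) z = (‖z‖ ^ 2 : ℝ) := by
  simp [EuclideanSpace.norm_sq_eq, Complex.mul_conj, Complex.normSq_eq_norm_sq]

/-- Interior estimate for the derivatives of M-harmonic functions. -/
lemma exists_nsqOn_opWord_wirtDer_le (hs : -1 < s) (l : List (Fin n ⊕ Fin n)) :
    ∃ K : ℝ≥0∞, K ≠ ⊤ ∧ ∀ g : smoothAlg n,
      (∀ z ∈ Metric.ball (0 : En n) (3 / 4), (lap n g : En n → ℂ) z = 0) →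
      nsqOn n s (Metric.ball 0 (1 / 2)) (opWord (fun i => wirtDer n i) l g : smoothAlg n) ≤
        K * nsqOn n s (Metric.ball 0 (3 / 4)) g := by
  choose F hF hF' using fun l' : List (Fin n ⊕ Fin n) =>
    exists_nsqOn_opWord_autDer_le (n := n) hs l' (r := 1 / 2) (R := 3 / 4) (by norm_num)
      (by norm_num) (by norm_num)
  obtain ⟨K₁, hK₁, h₁⟩ := exists_forall_length_le l.length hF
  obtain ⟨K₂, hK₂, h₂⟩ := exists_nsqOn_opWord_le (n := n) hs (autDer n) (wirtDer n) _
    (smul_mem_span_mobFam _ _ _ _) (δ := 1 / 2) (by norm_num) l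
  refine ⟨K₂ * K₁, by finiteness, fun g hg => ?_⟩
  rw [mul_assoc]
  refine h₂ _ Metric.isOpen_ball.measurableSet (Metric.ball_subset_ball (by norm_num))
    (fun z hz => ?_) g _ fun l' hl' => (hF' l' g hg).trans (by gcongr; exact h₁ l' hl')
  have hz := mem_ball_zero_iff.1 hz
  have hz2 : ‖z‖ ^ 2 ≤ 1 / 4 := by nlinarith [norm_nonneg z]
  have : ((1 - (∑ j, coord j * conj (coord j)) ^ 2 : smoothAlg n) : En n → ℂ) z =
      (1 - (‖z‖ ^ 2) ^ 2 : ℝ) := by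
    have := sum_coord_mul_conj_apply z
    simp only [Subalgebra.coe_sub, Subalgebra.coe_one, SubmonoidClass.coe_pow, Pi.sub_apply,
      Pi.one_apply, Pi.pow_apply, this]
    push_cast
    rfl
  rw [this, Complex.norm_real]
  refine le_trans ?_ (Real.le_norm_self _)
  nlinarith [sq_nonneg ‖z‖]

end InteriorEstimates

section NormEquivalence

open smoothAlg

variable {n : ℕ} {s : ℝ}

lemma lap_apply (g : smoothAlg n) (z : En n) :
    (lap n g : En n → ℂ) z = ∑ j : Fin n, ∑ k : Fin n,
      ((if j = k then 1 else 0) - z j * starRingEnd ℂ (z k)) * wd n j (wdb n k g) z := by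
  have h : lap n g = ∑ j, dz j (dzb j g) -
      ∑ j, ∑ k, coord j * conj (coord k) * dz j (dzb k g) := by
    have (j k : Fin n) : dz j (conj (coord k) * dzb k g) =
        conj (coord k) * dz j (dzb k g) := by
      rw [Derivation.leibniz, (wirtingerSystem n).d_y]
      simp
    rw [lap, mobLap, eulerDer_apply, eulerDer_apply]
    simp only [map_sum, this, Finset.mul_sum, mul_assoc]
  rw [h]
  simp [sub_mul, Finset.sum_sub_distrib]

lemma MHarm.exists_eqOn {f : En n → ℂ} (hf : MHarm n ⊤ f) {r : ℝ} (hr : r < 1) :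
    ∃ g : smoothAlg n, Set.EqOn f g (Metric.ball 0 r) ∧
      ∀ z ∈ Metric.ball (0 : En n) r, (lap n g : En n → ℂ) z = 0 := by
  obtain ⟨g, hg⟩ := smoothAlg.exists_eqOn hf.1 hr
  refine ⟨g, hg, fun z hz => ?_⟩
  have hz1 := mem_ball_zero_iff.1 (Metric.ball_subset_ball hr.le hz)
  have h := hf.2 z (Metric.ball_subset_ball hr.le hz)
  have hne : (4 : ℂ) * (1 - (‖z‖ : ℂ) ^ 2) ≠ 0 := by
    have : (1 - ‖z‖ ^ 2 : ℝ) ≠ 0 := by nlinarith [norm_nonneg z]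
    exact_mod_cast mul_ne_zero four_ne_zero this
  rw [lap_apply, ← (mul_eq_zero_iff_left hne).1 h]
  refine Finset.sum_congr rfl fun j _ => Finset.sum_congr rfl fun k _ => ?_
  have := opWord_eqOn (wirtOp_eqOn Metric.isOpen_ball) [Sum.inl j, Sum.inr k] hg hz
  exact congrArg _ this.symm

variable {ι κ : Type*} {D : ι → Derivation ℂ (smoothAlg n) (smoothAlg n)}
  {E : κ → Derivation ℂ (smoothAlg n) (smoothAlg n)} {O : ι → (En n → ℂ) → En n → ℂ}
  {P : κ → (En n → ℂ) → En n → ℂ}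

/-- Transfer of `exists_nsqOn_opWord_le` to functions that are smooth on the unit ball. -/
lemma exists_nsqOn_opWord_le_of_contDiffOn (hs : -1 < s)
    (hD : ∀ i (f : smoothAlg n), (D i f : En n → ℂ) = O i f)
    (hO : ∀ V, IsOpen V → ∀ i f g, Set.EqOn f g V → Set.EqOn (O i f) (O i g) V)
    (hE : ∀ i (f : smoothAlg n), (E i f : En n → ℂ) = P i f)
    (hP : ∀ V, IsOpen V → ∀ i f g, Set.EqOn f g V → Set.EqOn (P i f) (P i g) V)
    (u : smoothAlg n)
    (hu : ∀ k, u • E k ∈ Submodule.span (smoothAlg n) (Set.range D)) {δ : ℝ} (hδ : 0 < δ)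
    {V : Set (En n)} (hV : MeasurableSet V) (hV' : V ⊆ Metric.ball 0 1)
    (huV : ∀ z ∈ V, δ ≤ ‖(u : En n → ℂ) z‖) (l : List κ) :
    ∃ K : ℝ≥0∞, K ≠ ⊤ ∧ ∀ f : En n → ℂ, ContDiffOn ℝ (⊤ : ℕ∞) f (Metric.ball 0 1) →
      ∀ B : ℝ≥0∞, (∀ l' : List ι, l'.length ≤ l.length → nsqOn n s V (opWord O l' f) ≤ B) →
        nsqOn n s V (opWord P l f) ≤ K * B := by
  obtain ⟨K, hK, h⟩ := exists_nsqOn_opWord_le hs D E u hu hδ l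
  refine ⟨K, hK, fun f hf B hB => nsqOn_le_of_forall_inter_ball hV' fun r hr => ?_⟩
  obtain ⟨g, hg⟩ := smoothAlg.exists_eqOn hf hr
  have hVr := hV.inter (Metric.isOpen_ball (x := (0 : En n)) (ε := r)).measurableSet
  have hw := opWord_eqOn (hP _ Metric.isOpen_ball) l hg
  rw [nsqOn_congr hVr (hw.mono Set.inter_subset_right), ← coe_opWord hE]
  refine h _ hVr (Set.inter_subset_left.trans hV') (fun z hz => huV z hz.1) g B fun l' hl' => ?_
  have hw' := opWord_eqOn (hO _ Metric.isOpen_ball) l' hg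
  rw [coe_opWord hD, ← nsqOn_congr hVr (hw'.mono Set.inter_subset_right)]
  exact (nsqOn_mono_set Set.inter_subset_left _).trans (hB l' hl')

lemma exists_nsqE_polarOp_le (hs : -1 < s) (l : List (Option (iotaX0 n))) :
    ∃ K : ℝ≥0∞, K ≠ ⊤ ∧ ∀ f : En n → ℂ, ContDiffOn ℝ (⊤ : ℕ∞) f (Metric.ball 0 1) →
      ∀ B : ℝ≥0∞, (∀ l', l'.length ≤ l.length → nsqE n s (opWord (wirtOp n) l' f) ≤ B) →
        nsqE n s (opWord (polarOp n) l f) ≤ K * B :=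
  exists_nsqOn_opWord_le_of_contDiffOn hs (D := wirtDer n) (E := polDer n) coe_wirtDer
    (fun _ hV => wirtOp_eqOn hV) coe_polDer (fun _ hV => polarOp_eqOn hV) 1
    (fun k => by
      rw [one_smul]
      exact polarDer_mem_span dz dzb coord (fun j => conj (coord j)) k)
    one_pos Metric.isOpen_ball.measurableSet le_rfl (fun z _ => by simp) l

lemma exists_nsqE_wirtOp_le (hs : -1 < s) (l : List (Fin n ⊕ Fin n)) :
    ∃ K : ℝ≥0∞, K ≠ ⊤ ∧ ∀ f : En n → ℂ, MHarm n ⊤ f →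
      ∀ B : ℝ≥0∞, (∀ l', l'.length ≤ l.length → nsqE n s (opWord (polarOp n) l' f) ≤ B) →
        nsqE n s (opWord (wirtOp n) l f) ≤ K * B := by
  obtain ⟨K₁, hK₁, h₁⟩ := exists_nsqOn_opWord_wirtDer_le (n := n) hs l
  obtain ⟨K₂, hK₂, h₂⟩ := exists_nsqOn_opWord_le_of_contDiffOn (n := n) hs (D := polDer n)
    (E := wirtDer n) coe_polDer (fun _ hV => polarOp_eqOn hV) coe_wirtDer
    (fun _ hV => wirtOp_eqOn hV) _ (normSq_smul_mem_span _ _ _ _) (δ := 1 / 4) (by norm_num)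
    (V := Metric.ball 0 1 \ Metric.ball 0 (1 / 2))
    (Metric.isOpen_ball.measurableSet.diff Metric.isOpen_ball.measurableSet) Set.sdiff_subset
    (fun z hz => by
      have hz : 1 / 2 ≤ ‖z‖ := by simpa using hz.2
      rw [sum_coord_mul_conj_apply, Complex.norm_real]
      refine le_trans ?_ (Real.le_norm_self _)
      nlinarith) l
  refine ⟨K₁ + K₂, by finiteness, fun f hf B hB => ?_⟩
  have hsub : Metric.ball (0 : En n) (1 / 2) ⊆ Metric.ball 0 (3 / 4) :=
    Metric.ball_subset_ball (by norm_num)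
  obtain ⟨g, hg, hlap⟩ := hf.exists_eqOn (r := 3 / 4) (by norm_num)
  have hinner : nsqOn n s (Metric.ball 0 (1 / 2)) (opWord (wirtOp n) l f) ≤ K₁ * B := by
    rw [nsqOn_congr Metric.isOpen_ball.measurableSet
      ((opWord_eqOn (wirtOp_eqOn Metric.isOpen_ball) l hg).mono hsub), ← coe_opWord coe_wirtDer]
    refine (h₁ g hlap).trans ?_
    gcongr
    rw [← nsqOn_congr Metric.isOpen_ball.measurableSet hg]
    exact (nsqOn_mono_set (Metric.ball_subset_ball (by norm_num)) _).trans (hB [] (Nat.zero_le _))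
  have houter : nsqOn n s (Metric.ball 0 1 \ Metric.ball 0 (1 / 2)) (opWord (wirtOp n) l f) ≤
      K₂ * B :=
    h₂ f hf.1 B fun l' hl' => (nsqOn_mono_set Set.sdiff_subset _).trans (hB l' hl')
  calc _ ≤ nsqOn n s (Metric.ball 0 (1 / 2) ∪ Metric.ball 0 1 \ Metric.ball 0 (1 / 2))
          (opWord (wirtOp n) l f) :=
        nsqOn_mono_set (by rw [Set.union_sdiff_self]; exact Set.subset_union_right) _
    _ ≤ _ := lintegral_union_le _ _ _
    _ ≤ _ := by rw [add_mul]; exact add_le_add hinner houter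

lemma nsqE_opWord_congr (hD : ∀ i (f : smoothAlg n), (D i f : En n → ℂ) = O i f)
    (hO : ∀ V, IsOpen V → ∀ i f g, Set.EqOn f g V → Set.EqOn (O i f) (O i g) V) {l l' : List ι}
    (h : ∀ g : smoothAlg n, opWord (fun i => D i) l g = opWord (fun i => D i) l' g)
    {f : En n → ℂ} (hf : ContDiffOn ℝ (⊤ : ℕ∞) f (Metric.ball 0 1)) :
    nsqE n s (opWord O l f) = nsqE n s (opWord O l' f) := by
  refine nsqOn_congr Metric.isOpen_ball.measurableSet fun z hz => ?_
  obtain ⟨r, hr, hr1⟩ := exists_between (mem_ball_zero_iff.1 hz)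
  obtain ⟨g, hg⟩ := smoothAlg.exists_eqOn hf hr1
  have hz' := mem_ball_zero_iff.2 hr
  rw [opWord_eqOn (hO _ Metric.isOpen_ball) l hg hz',
    opWord_eqOn (hO _ Metric.isOpen_ball) l' hg hz', ← coe_opWord hD, ← coe_opWord hD, h]

lemma wirtDer_comm (i j : Fin n ⊕ Fin n) (f : smoothAlg n) :
    wirtDer n i (wirtDer n j f) = wirtDer n j (wirtDer n i f) := by
  have h := wirtingerSystem n
  rcases i with i | i <;> rcases j with j | j
  exacts [h.d_d i j f, h.d_e i j f, (h.d_e j i f).symm, h.e_e i j f]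

lemma nsqE_wirtOp_le_WmSqE {m : ℕ} {f : En n → ℂ}
    (hf : ContDiffOn ℝ (⊤ : ℕ∞) f (Metric.ball 0 1)) {l : List (Fin n ⊕ Fin n)}
    (hl : l.length ≤ m) : nsqE n s (opWord (wirtOp n) l f) ≤ WmSqE n m s f := by
  obtain ⟨α, β, hp⟩ := exists_perm_monomialWord l
  have hlen := length_monomialWord α β
  rw [← hp.length_eq] at hlen
  have hα j : α j < m + 1 := by
    have := Finset.single_le_sum (fun _ _ => Nat.zero_le _) (Finset.mem_univ j) (f := α)
    omega
  have hβ j : β j < m + 1 := by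
    have := Finset.single_le_sum (fun _ _ => Nat.zero_le _) (Finset.mem_univ j) (f := β)
    omega
  rw [nsqE_opWord_congr coe_wirtDer (fun _ hV => wirtOp_eqOn hV)
    (fun g => opWord_perm wirtDer_comm hp g) hf, opWord_wirtOp_monomialWord, WmSqE]
  refine le_trans ?_ (Finset.single_le_sum (fun _ _ => zero_le)
    (Finset.mem_univ fun j => (⟨α j, hα j⟩ : Fin (m + 1))))
  refine le_trans ?_ (Finset.single_le_sum (fun _ _ => zero_le)
    (Finset.mem_univ fun j => (⟨β j, hβ j⟩ : Fin (m + 1))))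
  rw [if_pos (show ∑ j, α j + ∑ j, β j ≤ m from hlen ▸ hl)]

lemma nsqE_polarOp_le_sum {m : ℕ} {f : En n → ℂ}
    (hf : ContDiffOn ℝ (⊤ : ℕ∞) f (Metric.ball 0 1)) {L : List (Option (iotaX0 n))}
    (hL : L.length ≤ m) :
    nsqE n s (opWord (polarOp n) L f) ≤ ∑ l ∈ Finset.range (m + 1), ∑ k ∈ Finset.range (l + 1),
      ∑ js : Fin (l - k) → iotaX0 n, nsqE n s ((Nop n)^[k] (iterX0 n js f)) := by
  obtain ⟨k, l', hlen, h⟩ := exists_opWord_eq_append (D := fun i => polDer n i)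
    (fun i f => (wirtingerSystem n).radDer_comm i f) L
  rw [nsqE_opWord_congr coe_polDer (fun _ hV => polarOp_eqOn hV) h hf]
  have key (p : ℕ) (hp : l'.length = p) :
      nsqE n s (opWord (polarOp n) (List.replicate k none ++ l'.map some) f) ≤
        ∑ js : Fin p → iotaX0 n, nsqE n s ((Nop n)^[k] (iterX0 n js f)) := by
    subst hp
    have := opWord_polarOp k _ l'.get f
    rw [List.ofFn_get] at this
    rw [this]
    exact Finset.single_le_sum (f := fun js => nsqE n s ((Nop n)^[k] (iterX0 n js f)))
      (fun _ _ => zero_le) (Finset.mem_univ l'.get)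
  refine (key (L.length - k) (by omega)).trans ?_
  refine le_trans ?_ (Finset.single_le_sum (fun _ _ => zero_le)
    (Finset.mem_range.2 (show L.length < m + 1 by omega)))
  exact Finset.single_le_sum (f := fun k => ∑ js : Fin (L.length - k) → iotaX0 n,
    nsqE n s ((Nop n)^[k] (iterX0 n js f))) (fun _ _ => zero_le)
    (Finset.mem_range.2 (show k < L.length + 1 by omega))

lemma exists_WmSqE_le (hs : -1 < s) (m : ℕ) :
    ∃ K : ℝ≥0∞, K ≠ ⊤ ∧ ∀ f : En n → ℂ, MHarm n ⊤ f →
      ∀ B : ℝ≥0∞, (∀ l, l.length ≤ m → nsqE n s (opWord (polarOp n) l f) ≤ B) →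
        WmSqE n m s f ≤ K * B := by
  choose F hF hF' using exists_nsqE_wirtOp_le (n := n) hs
  obtain ⟨K, hK, h⟩ := exists_forall_length_le m hF
  refine ⟨∑ _α : Fin n → Fin (m + 1), ∑ _β : Fin n → Fin (m + 1), K,
    ENNReal.sum_ne_top.2 fun _ _ => ENNReal.sum_ne_top.2 fun _ _ => hK, fun f hf B hB => ?_⟩
  simp only [WmSqE, Finset.sum_mul]
  refine Finset.sum_le_sum fun α _ => Finset.sum_le_sum fun β _ => ?_
  split_ifs with hαβ
  · rw [← opWord_wirtOp_monomialWord]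
    have hl := (length_monomialWord (fun j => (α j : ℕ)) fun j => (β j : ℕ)).trans_le hαβ
    exact (hF' _ f hf B fun l' hl' => hB l' (hl'.trans hl)).trans (by gcongr; exact h _ hl)
  · exact zero_le

lemma exists_sum_nsqE_le (hs : -1 < s) (m : ℕ) :
    ∃ K : ℝ≥0∞, K ≠ ⊤ ∧ ∀ f : En n → ℂ, ContDiffOn ℝ (⊤ : ℕ∞) f (Metric.ball 0 1) →
      ∀ B : ℝ≥0∞, (∀ l, l.length ≤ m → nsqE n s (opWord (wirtOp n) l f) ≤ B) →
        ∑ l ∈ Finset.range (m + 1), ∑ k ∈ Finset.range (l + 1),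
          ∑ js : Fin (l - k) → iotaX0 n, nsqE n s ((Nop n)^[k] (iterX0 n js f)) ≤ K * B := by
  choose F hF hF' using exists_nsqE_polarOp_le (n := n) hs
  obtain ⟨K, hK, h⟩ := exists_forall_length_le m hF
  refine ⟨∑ l ∈ Finset.range (m + 1), ∑ k ∈ Finset.range (l + 1),
    ∑ _js : Fin (l - k) → iotaX0 n, K, ENNReal.sum_ne_top.2 fun _ _ =>
      ENNReal.sum_ne_top.2 fun _ _ => ENNReal.sum_ne_top.2 fun _ _ => hK, fun f hf B hB => ?_⟩
  simp only [Finset.sum_mul]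
  refine Finset.sum_le_sum fun l hl => Finset.sum_le_sum fun k hk =>
    Finset.sum_le_sum fun js _ => ?_
  rw [Finset.mem_range] at hl hk
  rw [← opWord_polarOp]
  have hlen : (List.replicate k none ++ (List.ofFn js).map some).length ≤ m := by
    simp
    omega
  exact (hF' _ f hf B fun l' hl' => hB l' (hl'.trans hlen)).trans (by gcongr; exact h _ hlen)

end NormEquivalence

/-- Proposition 5.1, (a) ⟺ (c): for `M`-harmonic `f` and `0 ≤ m ≤ n`,
`‖f‖²_{W^m(μ_s)} ≍ Σ_{l=0}^m Σ_{k=0}^l Σ_{j₁,…,j_{l-k}} ‖N^k X_{j₁}⋯X_{j_{l-k}} f‖²_s`. -/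
theorem statement10 (n : ℕ) (hn : 2 ≤ n) (s : ℝ) (hs : -1 < s) (m : ℕ) (hm : m ≤ n) :
    ∃ c C : ℝ, 0 < c ∧ c < C ∧ ∀ f : En n → ℂ, MHarm n ⊤ f →
      ENNReal.ofReal c * WmSqE n m s f ≤
          (∑ l ∈ Finset.range (m + 1), ∑ k ∈ Finset.range (l + 1),
            ∑ js : Fin (l - k) → iotaX0 n, nsqE n s ((Nop n)^[k] (iterX0 n js f))) ∧
      (∑ l ∈ Finset.range (m + 1), ∑ k ∈ Finset.range (l + 1),
            ∑ js : Fin (l - k) → iotaX0 n, nsqE n s ((Nop n)^[k] (iterX0 n js f))) ≤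
        ENNReal.ofReal C * WmSqE n m s f := by
  obtain ⟨K, hK, hlow⟩ := exists_WmSqE_le (n := n) hs m
  obtain ⟨L, hL, hup⟩ := exists_sum_nsqE_le (n := n) hs m
  have hK0 : 0 < K.toReal + 1 := by positivity
  have hc : (K.toReal + 1)⁻¹ ≤ 1 := inv_le_one_of_one_le₀ (by simp)
  refine ⟨(K.toReal + 1)⁻¹, L.toReal + 2, by positivity, ?_, fun f hf => ⟨?_, ?_⟩⟩
  · have : 0 ≤ L.toReal := ENNReal.toReal_nonneg
    linarith
  · have h := hlow f hf _ fun l hl => nsqE_polarOp_le_sum hf.1 hl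
    refine (mul_le_mul_right h _).trans ?_
    rw [← mul_assoc]
    refine mul_le_of_le_one_left zero_le ?_
    rw [← ENNReal.ofReal_toReal hK, ← ENNReal.ofReal_mul (by positivity),
      ENNReal.ofReal_le_one, ENNReal.toReal_ofReal ENNReal.toReal_nonneg, inv_mul_le_iff₀ hK0]
    linarith
  · refine (hup f hf.1 _ fun l hl => nsqE_wirtOp_le_WmSqE hf.1 hl).trans ?_
    gcongr
    rw [← ENNReal.ofReal_toReal hL]
    refine ENNReal.ofReal_le_ofReal ?_
    rw [ENNReal.toReal_ofReal ENNReal.toReal_nonneg]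
    linarith
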